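/- Assume f, g are twice continuously differentiable and −f(x,·), g_i(x,·) are convex on ℝᵐ for all x near x̄. Suppose the restricted sup-compactness holds at x̄, a stable parametric CQ holds at every y ∈ S(x̄) for the parametric system g(x,·) ≤ 0, a stable CQ holds at every (x̄,ỹ,λ̃) with ỹ ∈ S(x̄), λ̃ ∈ Σ(x̄,ỹ) for the constraint system {(x,y,λ) : ∇_y L(x,y,λ) = 0, λ ≥ 0}, and V is continuous at x̄. If ∪_{y ∈ S(x̄)} {∇²_{xy}L(x̄,y,λ)u : u ∈ Ξ⁰(x̄,y,λ), λ ∈ Σ(x̄,y)} = {0}, then V is Lipschitz continuous near x̄ and ∂V(x̄) ⊆ ∪_{y ∈ S(x̄)} {∇_x L(x̄,y,λ) + ∇²_{xy}L(x̄,y,λ)u : u ∈ Ξ¹(x̄,y,λ), λ ∈ Σ(x̄,y)}. If in addition the latter set equals a singleton {ζ}, then V is strictly differentiable at x̄ with ∇V(x̄) = ζ. -/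

import Mathlib

open Filter Topology Metric RealInnerProductSpace

noncomputable section

/-- Feasible region of the parametric maximization problem. -/
def Feas {n m q : ℕ} (g : EuclideanSpace ℝ (Fin n) → EuclideanSpace ℝ (Fin m) → Fin q → ℝ)
    (x : EuclideanSpace ℝ (Fin n)) : Set (EuclideanSpace ℝ (Fin m)) :=
  {y | ∀ i, g x y i ≤ 0}

/-- Maximal value function (EReal valued; `sSup ∅ = ⊥ = -∞`). -/
def Vfun {n m q : ℕ} (f : EuclideanSpace ℝ (Fin n) → EuclideanSpace ℝ (Fin m) → ℝ)
    (g : EuclideanSpace ℝ (Fin n) → EuclideanSpace ℝ (Fin m) → Fin q → ℝ)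
    (x : EuclideanSpace ℝ (Fin n)) : EReal :=
  sSup ((fun y => (f x y : EReal)) '' Feas g x)

/-- Solution map of the parametric maximization problem. -/
def Sol {n m q : ℕ} (f : EuclideanSpace ℝ (Fin n) → EuclideanSpace ℝ (Fin m) → ℝ)
    (g : EuclideanSpace ℝ (Fin n) → EuclideanSpace ℝ (Fin m) → Fin q → ℝ)
    (x : EuclideanSpace ℝ (Fin n)) : Set (EuclideanSpace ℝ (Fin m)) :=
  {y ∈ Feas g x | (f x y : EReal) = Vfun f g x}

/-- Lagrangian `L(x,y,λ) = f(x,y) - λᵀ g(x,y)`. -/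
def Lag {n m q : ℕ} (f : EuclideanSpace ℝ (Fin n) → EuclideanSpace ℝ (Fin m) → ℝ)
    (g : EuclideanSpace ℝ (Fin n) → EuclideanSpace ℝ (Fin m) → Fin q → ℝ)
    (x : EuclideanSpace ℝ (Fin n)) (y : EuclideanSpace ℝ (Fin m)) (lam : Fin q → ℝ) : ℝ :=
  f x y - ∑ i, lam i * g x y i

/-- Partial gradient in `x`. -/
def gradx {n m : ℕ} (φ : EuclideanSpace ℝ (Fin n) → EuclideanSpace ℝ (Fin m) → ℝ)
    (x : EuclideanSpace ℝ (Fin n)) (y : EuclideanSpace ℝ (Fin m)) : EuclideanSpace ℝ (Fin n) :=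
  gradient (fun x' => φ x' y) x

/-- Partial gradient in `y`. -/
def grady {n m : ℕ} (φ : EuclideanSpace ℝ (Fin n) → EuclideanSpace ℝ (Fin m) → ℝ)
    (x : EuclideanSpace ℝ (Fin n)) (y : EuclideanSpace ℝ (Fin m)) : EuclideanSpace ℝ (Fin m) :=
  gradient (fun y' => φ x y') y

/-- `∇_y L(x,y,λ)`. -/
def gradyL {n m q : ℕ} (f : EuclideanSpace ℝ (Fin n) → EuclideanSpace ℝ (Fin m) → ℝ)
    (g : EuclideanSpace ℝ (Fin n) → EuclideanSpace ℝ (Fin m) → Fin q → ℝ)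
    (x : EuclideanSpace ℝ (Fin n)) (y : EuclideanSpace ℝ (Fin m)) (lam : Fin q → ℝ) :
    EuclideanSpace ℝ (Fin m) :=
  grady (fun x y => Lag f g x y lam) x y

/-- `∇_x L(x,y,λ)`. -/
def gradxL {n m q : ℕ} (f : EuclideanSpace ℝ (Fin n) → EuclideanSpace ℝ (Fin m) → ℝ)
    (g : EuclideanSpace ℝ (Fin n) → EuclideanSpace ℝ (Fin m) → Fin q → ℝ)
    (x : EuclideanSpace ℝ (Fin n)) (y : EuclideanSpace ℝ (Fin m)) (lam : Fin q → ℝ) :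
    EuclideanSpace ℝ (Fin n) :=
  gradx (fun x y => Lag f g x y lam) x y

/-- `∇_y g(x,y)ᵀ u ∈ ℝ^q`. -/
def gyTu {n m q : ℕ} (g : EuclideanSpace ℝ (Fin n) → EuclideanSpace ℝ (Fin m) → Fin q → ℝ)
    (x : EuclideanSpace ℝ (Fin n)) (y : EuclideanSpace ℝ (Fin m)) (u : EuclideanSpace ℝ (Fin m)) :
    Fin q → ℝ :=
  fun i => ⟪grady (fun x y => g x y i) x y, u⟫

/-- `∇²_{yy} L(x,y,λ) u`. -/
def hessyyLu {n m q : ℕ} (f : EuclideanSpace ℝ (Fin n) → EuclideanSpace ℝ (Fin m) → ℝ)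
    (g : EuclideanSpace ℝ (Fin n) → EuclideanSpace ℝ (Fin m) → Fin q → ℝ)
    (x : EuclideanSpace ℝ (Fin n)) (y : EuclideanSpace ℝ (Fin m)) (lam : Fin q → ℝ)
    (u : EuclideanSpace ℝ (Fin m)) : EuclideanSpace ℝ (Fin m) :=
  gradient (fun y' => ⟪gradyL f g x y' lam, u⟫) y

/-- `∇²_{xy} L(x,y,λ) u ∈ ℝⁿ` (for `u ∈ ℝᵐ`). -/
def hessxyLu {n m q : ℕ} (f : EuclideanSpace ℝ (Fin n) → EuclideanSpace ℝ (Fin m) → ℝ)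
    (g : EuclideanSpace ℝ (Fin n) → EuclideanSpace ℝ (Fin m) → Fin q → ℝ)
    (x : EuclideanSpace ℝ (Fin n)) (y : EuclideanSpace ℝ (Fin m)) (lam : Fin q → ℝ)
    (u : EuclideanSpace ℝ (Fin m)) : EuclideanSpace ℝ (Fin n) :=
  gradient (fun x' => ⟪gradyL f g x' y lam, u⟫) x

/-- Multiplier set `Σ(x,y)`. -/
def SigmaSet {n m q : ℕ} (f : EuclideanSpace ℝ (Fin n) → EuclideanSpace ℝ (Fin m) → ℝ)
    (g : EuclideanSpace ℝ (Fin n) → EuclideanSpace ℝ (Fin m) → Fin q → ℝ)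
    (x : EuclideanSpace ℝ (Fin n)) (y : EuclideanSpace ℝ (Fin m)) : Set (Fin q → ℝ) :=
  {lam | gradyL f g x y lam = 0 ∧ (∀ i, 0 ≤ lam i) ∧ (∀ i, g x y i ≤ 0) ∧
    ∑ i, lam i * g x y i = 0}

/-- Singular multiplier set `Σ⁰(x,y)`. -/
def SigmaZero {n m q : ℕ} (g : EuclideanSpace ℝ (Fin n) → EuclideanSpace ℝ (Fin m) → Fin q → ℝ)
    (x : EuclideanSpace ℝ (Fin n)) (y : EuclideanSpace ℝ (Fin m)) : Set (Fin q → ℝ) :=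
  {lam | ∑ i, lam i • grady (fun x y => g x y i) x y = 0 ∧ (∀ i, 0 ≤ lam i) ∧
    (∀ i, g x y i ≤ 0) ∧ ∑ i, lam i * g x y i = 0}

/-- The set `Ξ^r(x,y,λ)`. -/
def XiSet {n m q : ℕ} (r : ℝ) (f : EuclideanSpace ℝ (Fin n) → EuclideanSpace ℝ (Fin m) → ℝ)
    (g : EuclideanSpace ℝ (Fin n) → EuclideanSpace ℝ (Fin m) → Fin q → ℝ)
    (x : EuclideanSpace ℝ (Fin n)) (y : EuclideanSpace ℝ (Fin m)) (lam : Fin q → ℝ) :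
    Set (EuclideanSpace ℝ (Fin m)) :=
  {u | hessyyLu f g x y lam u = 0 ∧ (∀ i, 0 ≤ -(gyTu g x y u i) - r * g x y i) ∧
    (∀ i, 0 ≤ lam i) ∧ ∑ i, lam i * (-(gyTu g x y u i) - r * g x y i) = 0}

/-- Fréchet (regular) subdifferential of an `EReal` valued function. -/
def FSub {n : ℕ} (φ : EuclideanSpace ℝ (Fin n) → EReal) (x₀ : EuclideanSpace ℝ (Fin n)) :
    Set (EuclideanSpace ℝ (Fin n)) :=
  {v | ∃ c : ℝ, φ x₀ = (c : EReal) ∧ ∀ ε : ℝ, 0 < ε → ∃ δ : ℝ, 0 < δ ∧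
    ∀ x, ‖x - x₀‖ < δ → ((c + ⟪v, x - x₀⟫ - ε * ‖x - x₀‖ : ℝ) : EReal) ≤ φ x}

/-- Limiting (Mordukhovich) subdifferential. -/
def LSub {n : ℕ} (φ : EuclideanSpace ℝ (Fin n) → EReal) (x₀ : EuclideanSpace ℝ (Fin n)) :
    Set (EuclideanSpace ℝ (Fin n)) :=
  {v | ∃ (xk : ℕ → EuclideanSpace ℝ (Fin n)) (vk : ℕ → EuclideanSpace ℝ (Fin n)),
    (∀ k, vk k ∈ FSub φ (xk k)) ∧ Tendsto xk atTop (𝓝 x₀) ∧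
    Tendsto (fun k => φ (xk k)) atTop (𝓝 (φ x₀)) ∧ Tendsto vk atTop (𝓝 v)}

/-- Horizon (singular) subdifferential. -/
def HorSub {n : ℕ} (φ : EuclideanSpace ℝ (Fin n) → EReal) (x₀ : EuclideanSpace ℝ (Fin n)) :
    Set (EuclideanSpace ℝ (Fin n)) :=
  {v | ∃ (xk : ℕ → EuclideanSpace ℝ (Fin n)) (vk : ℕ → EuclideanSpace ℝ (Fin n)) (tk : ℕ → ℝ),
    (∀ k, vk k ∈ FSub φ (xk k)) ∧ (∀ k, 0 < tk k) ∧ Tendsto tk atTop (𝓝 0) ∧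
    Tendsto xk atTop (𝓝 x₀) ∧ Tendsto (fun k => φ (xk k)) atTop (𝓝 (φ x₀)) ∧
    Tendsto (fun k => tk k • vk k) atTop (𝓝 v)}

/-- Clarke subdifferential (for locally Lipschitz functions): convex hull of the limiting one. -/
def CSub {n : ℕ} (φ : EuclideanSpace ℝ (Fin n) → EReal) (x₀ : EuclideanSpace ℝ (Fin n)) :
    Set (EuclideanSpace ℝ (Fin n)) :=
  convexHull ℝ (LSub φ x₀)

/-- `φ` is (finite-valued and) Lipschitz continuous near `x₀`. -/
def LipschitzNearAt {n : ℕ} (φ : EuclideanSpace ℝ (Fin n) → EReal)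
    (x₀ : EuclideanSpace ℝ (Fin n)) : Prop :=
  ∃ δ : ℝ, 0 < δ ∧ ∃ K : NNReal, ∃ ψ : EuclideanSpace ℝ (Fin n) → ℝ,
    LipschitzWith K ψ ∧ ∀ x ∈ ball x₀ δ, φ x = (ψ x : EReal)

/-- Regular (Fréchet) normal cone. -/
def regNC {n : ℕ} (C : Set (EuclideanSpace ℝ (Fin n))) (x₀ : EuclideanSpace ℝ (Fin n)) :
    Set (EuclideanSpace ℝ (Fin n)) :=
  {ξ | ∀ ε : ℝ, 0 < ε → ∃ δ : ℝ, 0 < δ ∧ ∀ x ∈ C, ‖x - x₀‖ < δ →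
    ⟪ξ, x - x₀⟫ ≤ ε * ‖x - x₀‖}

/-- Limiting (Mordukhovich) normal cone. -/
def limNC {n : ℕ} (C : Set (EuclideanSpace ℝ (Fin n))) (x₀ : EuclideanSpace ℝ (Fin n)) :
    Set (EuclideanSpace ℝ (Fin n)) :=
  {ξ | ∃ (xk : ℕ → EuclideanSpace ℝ (Fin n)) (ξk : ℕ → EuclideanSpace ℝ (Fin n)),
    (∀ k, xk k ∈ C) ∧ (∀ k, ξk k ∈ regNC C (xk k)) ∧
    Tendsto xk atTop (𝓝 x₀) ∧ Tendsto ξk atTop (𝓝 ξ)}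

/-- Inner semicontinuity of the solution map at `(x̄, ȳ)`. -/
def InnerSemicont {n m q : ℕ} (f : EuclideanSpace ℝ (Fin n) → EuclideanSpace ℝ (Fin m) → ℝ)
    (g : EuclideanSpace ℝ (Fin n) → EuclideanSpace ℝ (Fin m) → Fin q → ℝ)
    (xb : EuclideanSpace ℝ (Fin n)) (yb : EuclideanSpace ℝ (Fin m)) : Prop :=
  ∀ xk : ℕ → EuclideanSpace ℝ (Fin n), Tendsto xk atTop (𝓝 xb) →
    ∃ yk : ℕ → EuclideanSpace ℝ (Fin m), (∀ k, yk k ∈ Sol f g (xk k)) ∧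
      Tendsto yk atTop (𝓝 yb)

/-- Local error bound for the system `g(x,y) ≤ 0` at `(x̄, ȳ)`. -/
def LocalErrorBound {n m q : ℕ}
    (g : EuclideanSpace ℝ (Fin n) → EuclideanSpace ℝ (Fin m) → Fin q → ℝ)
    (xb : EuclideanSpace ℝ (Fin n)) (yb : EuclideanSpace ℝ (Fin m)) : Prop :=
  ∃ κ δ : ℝ, 0 < κ ∧ 0 < δ ∧
    ∀ x y, ‖((x, y) : EuclideanSpace ℝ (Fin n) × EuclideanSpace ℝ (Fin m)) - (xb, yb)‖ < δ →
      Metric.infDist ((x, y) : EuclideanSpace ℝ (Fin n) × EuclideanSpace ℝ (Fin m))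
          {p : EuclideanSpace ℝ (Fin n) × EuclideanSpace ℝ (Fin m) | ∀ i, g p.1 p.2 i ≤ 0}
        ≤ κ * ∑ i, max (g x y i) 0

/-- MFCQ for the system `g(x̄, ·) ≤ 0` at `ȳ`. -/
def MFCQy {n m q : ℕ} (g : EuclideanSpace ℝ (Fin n) → EuclideanSpace ℝ (Fin m) → Fin q → ℝ)
    (xb : EuclideanSpace ℝ (Fin n)) (yb : EuclideanSpace ℝ (Fin m)) : Prop :=
  ∀ lam : Fin q → ℝ, (∀ i, 0 ≤ lam i) → (∑ i, lam i * g xb yb i = 0) →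
    (∀ i, g xb yb i ≤ 0) → (∑ i, lam i • grady (fun x y => g x y i) xb yb = 0) → lam = 0

/-- Restricted sup-compactness at `x̄`. -/
def RestrictedSupCompact {n m q : ℕ}
    (f : EuclideanSpace ℝ (Fin n) → EuclideanSpace ℝ (Fin m) → ℝ)
    (g : EuclideanSpace ℝ (Fin n) → EuclideanSpace ℝ (Fin m) → Fin q → ℝ)
    (xb : EuclideanSpace ℝ (Fin n)) : Prop :=
  (∃ c : ℝ, Vfun f g xb = (c : EReal)) ∧
  ∃ ε δ : ℝ, 0 < ε ∧ 0 < δ ∧ ∃ Ω : Set (EuclideanSpace ℝ (Fin m)), IsCompact Ω ∧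
    ∀ x, ‖x - xb‖ < δ → Vfun f g xb - (ε : EReal) < Vfun f g x → (Sol f g x ∩ Ω).Nonempty

/-- Robinson stability of the feasible map at `(x̄, ȳ)`. -/
def RobinsonStability {n m q : ℕ}
    (g : EuclideanSpace ℝ (Fin n) → EuclideanSpace ℝ (Fin m) → Fin q → ℝ)
    (xb : EuclideanSpace ℝ (Fin n)) (yb : EuclideanSpace ℝ (Fin m)) : Prop :=
  ∃ κ δ : ℝ, 0 < κ ∧ 0 < δ ∧
    ∀ x y, ‖((x, y) : EuclideanSpace ℝ (Fin n) × EuclideanSpace ℝ (Fin m)) - (xb, yb)‖ < δ →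
      Metric.infDist y (Feas g x) ≤ κ * ∑ i, max (g x y i) 0

/-- A constraint qualification holds at the feasible point `w₀` of the system
`{w : G w ≤ 0, H w = 0}`: local minimizers of C¹ functions over the feasible set
satisfy the KKT conditions. -/
def CQAt {W : Type} [NormedAddCommGroup W] [NormedSpace ℝ W] {p p' : ℕ}
    (G : W → Fin p → ℝ) (H : W → Fin p' → ℝ) (w₀ : W) : Prop :=
  ∀ θ : W → ℝ, ContDiff ℝ 1 θ →
    IsLocalMinOn θ {w | (∀ i, G w i ≤ 0) ∧ ∀ j, H w j = 0} w₀ →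
    ∃ (lam : Fin p → ℝ) (mu : Fin p' → ℝ), (∀ i, 0 ≤ lam i) ∧
      (fderiv ℝ θ w₀ + ∑ i, lam i • fderiv ℝ (fun w => G w i) w₀ +
        ∑ j, mu j • fderiv ℝ (fun w => H w j) w₀ = 0) ∧
      ∑ i, lam i * G w₀ i = 0

/-- Inequality constraints of the Wolfe dual system (`λ ≥ 0`). -/
def WolfeG (n m q : ℕ) :
    (EuclideanSpace ℝ (Fin n) × EuclideanSpace ℝ (Fin m) × (Fin q → ℝ)) → Fin q → ℝ :=
  fun w i => -(w.2.2 i)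

/-- Equality constraints of the Wolfe dual system (`∇_y L(x,y,λ) = 0`). -/
def WolfeH {n m q : ℕ} (f : EuclideanSpace ℝ (Fin n) → EuclideanSpace ℝ (Fin m) → ℝ)
    (g : EuclideanSpace ℝ (Fin n) → EuclideanSpace ℝ (Fin m) → Fin q → ℝ) :
    (EuclideanSpace ℝ (Fin n) × EuclideanSpace ℝ (Fin m) × (Fin q → ℝ)) → Fin m → ℝ :=
  fun w j => gradyL f g w.1 w.2.1 w.2.2 j

/-- The multiplier set `M(β, x, y)` of the parametric program. -/
def MultSetP {n m q : ℕ} (g : EuclideanSpace ℝ (Fin n) → EuclideanSpace ℝ (Fin m) → Fin q → ℝ)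
    (β : EuclideanSpace ℝ (Fin m)) (x : EuclideanSpace ℝ (Fin n))
    (y : EuclideanSpace ℝ (Fin m)) : Set (Fin q → ℝ) :=
  {lam | β - ∑ i, lam i • grady (fun x y => g x y i) x y = 0 ∧ (∀ i, 0 ≤ lam i) ∧
    ∑ i, lam i * g x y i = 0 ∧ ∀ i, g x y i ≤ 0}

/-- A stable parametric CQ holds at `ȳ ∈ F(x̄)` for the parametric system `g(x,·) ≤ 0`. -/
def StableParamCQ {n m q : ℕ} (f : EuclideanSpace ℝ (Fin n) → EuclideanSpace ℝ (Fin m) → ℝ)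
    (g : EuclideanSpace ℝ (Fin n) → EuclideanSpace ℝ (Fin m) → Fin q → ℝ)
    (xb : EuclideanSpace ℝ (Fin n)) (yb : EuclideanSpace ℝ (Fin m)) : Prop :=
  ∃ P : EuclideanSpace ℝ (Fin n) → EuclideanSpace ℝ (Fin m) → Prop,
    (∃ δ : ℝ, 0 < δ ∧ ∀ x y, y ∈ Feas g x → ‖x - xb‖ < δ → ‖y - yb‖ < δ → P x y) ∧
    (∀ x y, P x y → y ∈ Feas g x → IsLocalMaxOn (f x) (Feas g x) y →
      (MultSetP g (grady f x y) x y).Nonempty) ∧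
    (∀ (βk : ℕ → EuclideanSpace ℝ (Fin m)) (xk : ℕ → EuclideanSpace ℝ (Fin n))
        (yk : ℕ → EuclideanSpace ℝ (Fin m)) (βb : EuclideanSpace ℝ (Fin m)),
      Tendsto βk atTop (𝓝 βb) → Tendsto xk atTop (𝓝 xb) → Tendsto yk atTop (𝓝 yb) →
      (∀ k, (MultSetP g (βk k) (xk k) (yk k)).Nonempty) →
      ∃ (lamk : ℕ → Fin q → ℝ) (φ : ℕ → ℕ) (lamb : Fin q → ℝ),
        StrictMono φ ∧ (∀ k, lamk k ∈ MultSetP g (βk k) (xk k) (yk k)) ∧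
        Tendsto (lamk ∘ φ) atTop (𝓝 lamb) ∧ lamb ∈ MultSetP g βb xb yb)

/-- The multiplier set `M(β, w)` of a (nonparametric) system `{w : G w ≤ 0, H w = 0}`. -/
def MultSetW {W : Type} [NormedAddCommGroup W] [NormedSpace ℝ W] {p p' : ℕ}
    (G : W → Fin p → ℝ) (H : W → Fin p' → ℝ) (β : W →L[ℝ] ℝ) (w : W) :
    Set ((Fin p → ℝ) × (Fin p' → ℝ)) :=
  {lm | (∀ i, 0 ≤ lm.1 i) ∧
    (β - ∑ i, lm.1 i • fderiv ℝ (fun w => G w i) w -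
      ∑ j, lm.2 j • fderiv ℝ (fun w => H w j) w = 0) ∧
    ∑ i, lm.1 i * G w i = 0}

/-- A stable CQ holds at the feasible point `w̄` of the system `{w : G w ≤ 0, H w = 0}`. -/
def StableCQ {W : Type} [NormedAddCommGroup W] [NormedSpace ℝ W] {p p' : ℕ}
    (G : W → Fin p → ℝ) (H : W → Fin p' → ℝ) (wb : W) : Prop :=
  ∃ P : W → Prop,
    (P wb ∧ ∃ δ : ℝ, 0 < δ ∧ ∀ w, (∀ i, G w i ≤ 0) → (∀ j, H w j = 0) → ‖w - wb‖ < δ → P w) ∧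
    (∀ w, P w → (∀ i, G w i ≤ 0) → (∀ j, H w j = 0) →
      ∀ θ : W → ℝ, ContDiff ℝ 1 θ →
        IsLocalMinOn θ {w' | (∀ i, G w' i ≤ 0) ∧ ∀ j, H w' j = 0} w →
        ∃ (lam : Fin p → ℝ) (mu : Fin p' → ℝ), (∀ i, 0 ≤ lam i) ∧
          (fderiv ℝ θ w + ∑ i, lam i • fderiv ℝ (fun w => G w i) w +
            ∑ j, mu j • fderiv ℝ (fun w => H w j) w = 0) ∧
          ∑ i, lam i * G w i = 0) ∧
    (∀ (βk : ℕ → W →L[ℝ] ℝ) (wk : ℕ → W) (βb : W →L[ℝ] ℝ),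
      Tendsto βk atTop (𝓝 βb) → Tendsto wk atTop (𝓝 wb) →
      (∀ k, (∀ i, G (wk k) i ≤ 0) ∧ ∀ j, H (wk k) j = 0) →
      (∀ k, (MultSetW G H (βk k) (wk k)).Nonempty) →
      ∃ (lmk : ℕ → (Fin p → ℝ) × (Fin p' → ℝ)) (φ : ℕ → ℕ) (lmb : (Fin p → ℝ) × (Fin p' → ℝ)),
        StrictMono φ ∧ (∀ k, lmk k ∈ MultSetW G H (βk k) (wk k)) ∧
        Tendsto (lmk ∘ φ) atTop (𝓝 lmb) ∧ lmb ∈ MultSetW G H βb wb)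

/-- Critical cone of `(P_x̄)` at `y` associated with the multiplier `λ`. -/
def CritCone {n m q : ℕ} (g : EuclideanSpace ℝ (Fin n) → EuclideanSpace ℝ (Fin m) → Fin q → ℝ)
    (xb : EuclideanSpace ℝ (Fin n)) (y : EuclideanSpace ℝ (Fin m)) (lam : Fin q → ℝ) :
    Set (EuclideanSpace ℝ (Fin m)) :=
  {d | ∀ i, g xb y i = 0 →
    (0 < lam i → ⟪grady (fun x y => g x y i) xb y, d⟫ = 0) ∧
    (lam i = 0 → ⟪grady (fun x y => g x y i) xb y, d⟫ ≤ 0)}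

/-- Second order sufficient condition at `(y, λ)` for `(P_x̄)`. -/
def SOSC {n m q : ℕ} (f : EuclideanSpace ℝ (Fin n) → EuclideanSpace ℝ (Fin m) → ℝ)
    (g : EuclideanSpace ℝ (Fin n) → EuclideanSpace ℝ (Fin m) → Fin q → ℝ)
    (xb : EuclideanSpace ℝ (Fin n)) (y : EuclideanSpace ℝ (Fin m)) (lam : Fin q → ℝ) : Prop :=
  ∀ d ∈ CritCone g xb y lam, d ≠ 0 → ⟪d, hessyyLu f g xb y lam d⟫ < 0

/-- `(x̄, ȳ)` is a local solution of the minimax problem in the sense of Stackelberg. -/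
def StackelbergLocal {n m q : ℕ} (f : EuclideanSpace ℝ (Fin n) → EuclideanSpace ℝ (Fin m) → ℝ)
    (g : EuclideanSpace ℝ (Fin n) → EuclideanSpace ℝ (Fin m) → Fin q → ℝ)
    (X : Set (EuclideanSpace ℝ (Fin n))) (xb : EuclideanSpace ℝ (Fin n))
    (yb : EuclideanSpace ℝ (Fin m)) : Prop :=
  xb ∈ X ∧ yb ∈ Sol f g xb ∧ IsLocalMinOn (Vfun f g) X xb

/-- Feasible region of the MPEC reformulation `(P_MPEC)`. -/
def MPECFeas {n m q : ℕ} (f : EuclideanSpace ℝ (Fin n) → EuclideanSpace ℝ (Fin m) → ℝ)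
    (g : EuclideanSpace ℝ (Fin n) → EuclideanSpace ℝ (Fin m) → Fin q → ℝ)
    (X : Set (EuclideanSpace ℝ (Fin n))) :
    Set (EuclideanSpace ℝ (Fin n) × EuclideanSpace ℝ (Fin m) × (Fin q → ℝ)) :=
  {w | w.1 ∈ X ∧ gradyL f g w.1 w.2.1 w.2.2 = 0 ∧ (∀ i, g w.1 w.2.1 i ≤ 0) ∧
    (∀ i, 0 ≤ w.2.2 i) ∧ ∑ i, w.2.2 i * g w.1 w.2.1 i = 0}

/-- S-stationarity for `(P_MPEC)`. -/
def SStationary {n m q : ℕ} (f : EuclideanSpace ℝ (Fin n) → EuclideanSpace ℝ (Fin m) → ℝ)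
    (g : EuclideanSpace ℝ (Fin n) → EuclideanSpace ℝ (Fin m) → Fin q → ℝ)
    (X : Set (EuclideanSpace ℝ (Fin n))) (xb : EuclideanSpace ℝ (Fin n))
    (yb : EuclideanSpace ℝ (Fin m)) (lamb : Fin q → ℝ) : Prop :=
  ∃ (u : EuclideanSpace ℝ (Fin m)) (α β : Fin q → ℝ),
    -(gradx f xb yb + ∑ i, α i • gradx (fun x y => g x y i) xb yb +
        hessxyLu f g xb yb lamb u) ∈ limNC X xb ∧
    grady f xb yb + ∑ i, α i • grady (fun x y => g x y i) xb yb +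
      hessyyLu f g xb yb lamb u = 0 ∧
    (∀ i, -(gyTu g xb yb u i) - β i = 0) ∧
    (∀ i, g xb yb i < 0 → lamb i = 0 → α i = 0) ∧
    (∀ i, g xb yb i = 0 → 0 < lamb i → β i = 0) ∧
    (∀ i, g xb yb i = 0 → lamb i = 0 → 0 ≤ α i ∧ 0 ≤ β i)


/-- Optimal value function of the Wolfe dual (`sInf ∅ = ⊤`). -/
def VD {n m q : ℕ} (f : EuclideanSpace ℝ (Fin n) → EuclideanSpace ℝ (Fin m) → ℝ)
    (g : EuclideanSpace ℝ (Fin n) → EuclideanSpace ℝ (Fin m) → Fin q → ℝ)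
    (x : EuclideanSpace ℝ (Fin n)) : EReal :=
  sInf ((fun p : EuclideanSpace ℝ (Fin m) × (Fin q → ℝ) => (Lag f g x p.1 p.2 : EReal)) ''
    {p | gradyL f g x p.1 p.2 = 0 ∧ ∀ i, 0 ≤ p.2 i})

/-- Strict differentiability of an `EReal`-valued function at `x₀` with gradient `ζ`. -/
def StrictDiffAt {n : ℕ} (φ : EuclideanSpace ℝ (Fin n) → EReal)
    (x₀ ζ : EuclideanSpace ℝ (Fin n)) : Prop :=
  ∀ ε : ℝ, 0 < ε → ∃ δ : ℝ, 0 < δ ∧ ∀ x x', ‖x - x₀‖ < δ → ‖x' - x₀‖ < δ →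
    ∃ a b : ℝ, φ x = (a : EReal) ∧ φ x' = (b : EReal) ∧
      |a - b - ⟪ζ, x - x'⟫| ≤ ε * ‖x - x'‖

/-- `f` and `g` are separable with respect to `x` and `y`. -/
def SeparableFG {n m q : ℕ} (f : EuclideanSpace ℝ (Fin n) → EuclideanSpace ℝ (Fin m) → ℝ)
    (g : EuclideanSpace ℝ (Fin n) → EuclideanSpace ℝ (Fin m) → Fin q → ℝ) : Prop :=
  ∃ (f₁ : EuclideanSpace ℝ (Fin n) → ℝ) (f₂ : EuclideanSpace ℝ (Fin m) → ℝ)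
    (g₁ : EuclideanSpace ℝ (Fin n) → Fin q → ℝ) (g₂ : EuclideanSpace ℝ (Fin m) → Fin q → ℝ),
    (∀ x y, f x y = f₁ x + f₂ y) ∧ ∀ x y i, g x y i = g₁ x i + g₂ y i

end

section

variable {n m q : ℕ} {f : EuclideanSpace ℝ (Fin n) → EuclideanSpace ℝ (Fin m) → ℝ}
  {g : EuclideanSpace ℝ (Fin n) → EuclideanSpace ℝ (Fin m) → Fin q → ℝ}

section Smoothness

theorem grady_eq {φ : EuclideanSpace ℝ (Fin n) → EuclideanSpace ℝ (Fin m) → ℝ}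
    {x : EuclideanSpace ℝ (Fin n)} {y : EuclideanSpace ℝ (Fin m)}
    (h : DifferentiableAt ℝ
      (fun p : EuclideanSpace ℝ (Fin n) × EuclideanSpace ℝ (Fin m) => φ p.1 p.2) (x, y)) :
    grady φ x y = (InnerProductSpace.toDual ℝ (EuclideanSpace ℝ (Fin m))).symm
      ((fderiv ℝ (fun p : EuclideanSpace ℝ (Fin n) × EuclideanSpace ℝ (Fin m) => φ p.1 p.2)
        (x, y)).comp (ContinuousLinearMap.inr ℝ _ _)) := by
  unfold grady gradient
  congr 1
  exact (h.hasFDerivAt.comp y (hasFDerivAt_prodMk_right x y)).fderiv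

theorem contDiff_grady {φ : EuclideanSpace ℝ (Fin n) → EuclideanSpace ℝ (Fin m) → ℝ}
    (h : ContDiff ℝ 2
      (fun p : EuclideanSpace ℝ (Fin n) × EuclideanSpace ℝ (Fin m) => φ p.1 p.2)) :
    ContDiff ℝ 1
      (fun p : EuclideanSpace ℝ (Fin n) × EuclideanSpace ℝ (Fin m) => grady φ p.1 p.2) := by
  have h1 : ContDiff ℝ 1 (fderiv ℝ
      (fun p : EuclideanSpace ℝ (Fin n) × EuclideanSpace ℝ (Fin m) => φ p.1 p.2)) :=
    h.fderiv_right (by norm_num)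
  have h2 : (fun p : EuclideanSpace ℝ (Fin n) × EuclideanSpace ℝ (Fin m) => grady φ p.1 p.2) =
      fun p => (InnerProductSpace.toDual ℝ (EuclideanSpace ℝ (Fin m))).symm
      ((fderiv ℝ (fun p : EuclideanSpace ℝ (Fin n) × EuclideanSpace ℝ (Fin m) => φ p.1 p.2)
        p).comp (ContinuousLinearMap.inr ℝ _ _)) := by
    funext p
    exact grady_eq (h.differentiable (by norm_num) _)
  rw [h2]
  exact (InnerProductSpace.toDual ℝ (EuclideanSpace ℝ (Fin m))).symm.contDiff.comp
    (h1.clm_comp contDiff_const)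

theorem differentiableAt_right_of_contDiff
    {φ : EuclideanSpace ℝ (Fin n) → EuclideanSpace ℝ (Fin m) → ℝ}
    (h : ContDiff ℝ 2
      (fun p : EuclideanSpace ℝ (Fin n) × EuclideanSpace ℝ (Fin m) => φ p.1 p.2))
    (x : EuclideanSpace ℝ (Fin n)) (y : EuclideanSpace ℝ (Fin m)) :
    DifferentiableAt ℝ (φ x) y :=
  ((h.differentiable (by norm_num)).comp
    (differentiable_const x |>.prodMk differentiable_id)) y

variable (hf : ContDiff ℝ 2
    (fun p : EuclideanSpace ℝ (Fin n) × EuclideanSpace ℝ (Fin m) => f p.1 p.2))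
  (hg : ∀ i, ContDiff ℝ 2
    (fun p : EuclideanSpace ℝ (Fin n) × EuclideanSpace ℝ (Fin m) => g p.1 p.2 i))

include hf hg

theorem gradyL_eq (x : EuclideanSpace ℝ (Fin n)) (y : EuclideanSpace ℝ (Fin m))
    (lam : Fin q → ℝ) :
    gradyL f g x y lam =
      grady f x y - ∑ i, lam i • grady (fun x y => g x y i) x y := by
  have h1 : HasFDerivAt (fun y' => f x y' - ∑ i, lam i * g x y' i)
      (fderiv ℝ (f x) y - ∑ i, lam i • fderiv ℝ (fun y' => g x y' i) y) y := by
    refine (differentiableAt_right_of_contDiff hf x y).hasFDerivAt.sub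
      (HasFDerivAt.fun_sum fun i _ => ?_)
    exact (differentiableAt_right_of_contDiff (φ := fun x y => g x y i) (hg i) x y).hasFDerivAt.const_mul (lam i)
  unfold gradyL grady gradient Lag
  rw [h1.fderiv]
  simp [map_sub, map_sum]

theorem contDiff_gradyL :
    ContDiff ℝ 1 (fun w : EuclideanSpace ℝ (Fin n) × EuclideanSpace ℝ (Fin m) × (Fin q → ℝ) =>
      gradyL f g w.1 w.2.1 w.2.2) := by
  simp only [gradyL_eq hf hg]
  refine ((contDiff_grady hf).comp (contDiff_fst.prodMk (contDiff_fst.comp contDiff_snd))).sub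
    (ContDiff.sum fun i _ => ContDiff.fun_smul ?_ ?_)
  · exact (contDiff_apply ℝ ℝ i).comp (contDiff_snd.comp contDiff_snd)
  · exact (contDiff_grady (φ := fun x y => g x y i) (hg i)).comp (contDiff_fst.prodMk (contDiff_fst.comp contDiff_snd))

theorem contDiff_Lag :
    ContDiff ℝ 1 (fun w : EuclideanSpace ℝ (Fin n) × EuclideanSpace ℝ (Fin m) × (Fin q → ℝ) =>
      Lag f g w.1 w.2.1 w.2.2) := by
  unfold Lag
  refine ((hf.of_le (by norm_num)).comp
    (contDiff_fst.prodMk (contDiff_fst.comp contDiff_snd))).sub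
    (ContDiff.sum fun i _ => ContDiff.mul ?_ ?_)
  · exact (contDiff_apply ℝ ℝ i).comp (contDiff_snd.comp contDiff_snd)
  · exact ((hg i).of_le (by norm_num)).comp
      (contDiff_fst.prodMk (contDiff_fst.comp contDiff_snd))

end Smoothness

section PartialDerivatives

variable {F : EuclideanSpace ℝ (Fin n) × EuclideanSpace ℝ (Fin m) × (Fin q → ℝ) → ℝ}
  {x : EuclideanSpace ℝ (Fin n)} {y : EuclideanSpace ℝ (Fin m)} {lam : Fin q → ℝ}

theorem inner_gradient_fst (hF : DifferentiableAt ℝ F (x, y, lam))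
    (d : EuclideanSpace ℝ (Fin n)) :
    ⟪gradient (fun x' => F (x', y, lam)) x, d⟫ = fderiv ℝ F (x, y, lam) (d, 0, 0) := by
  have h := HasFDerivAt.comp (f := fun x' => (x', y, lam)) x hF.hasFDerivAt
    (hasFDerivAt_prodMk_left x (y, lam))
  have h' : fderiv ℝ (fun x' => F (x', y, lam)) x = _ := h.fderiv
  rw [gradient, InnerProductSpace.toDual_symm_apply, h']
  rfl

theorem inner_gradient_snd (hF : DifferentiableAt ℝ F (x, y, lam))
    (d : EuclideanSpace ℝ (Fin m)) :
    ⟪gradient (fun y' => F (x, y', lam)) y, d⟫ = fderiv ℝ F (x, y, lam) (0, d, 0) := by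
  have h := HasFDerivAt.comp (f := fun y' => (x, y', lam)) y hF.hasFDerivAt
    (HasFDerivAt.comp (f := fun y' => (y', lam)) y (hasFDerivAt_prodMk_right x (y, lam))
      (hasFDerivAt_prodMk_left y lam))
  have h' : fderiv ℝ (fun y' => F (x, y', lam)) y = _ := h.fderiv
  rw [gradient, InnerProductSpace.toDual_symm_apply, h']
  simp

theorem fderiv_apply_of_affine {W : Type*} [NormedAddCommGroup W] [NormedSpace ℝ W]
    {F : W → ℝ} {w e : W} (hF : DifferentiableAt ℝ F w) {c : ℝ}
    (h : ∀ t : ℝ, F (w + t • e) = F w + t * c) : fderiv ℝ F w e = c := by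
  rw [← hF.lineDeriv_eq_fderiv, lineDeriv]
  simp only [h]
  simp

end PartialDerivatives

section Duality

theorem ConcaveOn.le_of_fderiv_eq_zero {E : Type*} [NormedAddCommGroup E] [NormedSpace ℝ E]
    {h : E → ℝ} (hc : ConcaveOn ℝ Set.univ h) {a : E} (hd : DifferentiableAt ℝ h a)
    (h0 : fderiv ℝ h a = 0) (b : E) : h b ≤ h a := by
  by_contra! hlt
  have hline : HasDerivAt (fun t : ℝ => h (a + t • (b - a))) 0 0 := by
    have := hd.hasFDerivAt.hasLineDerivAt (b - a)
    rw [h0] at this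
    simpa [HasLineDerivAt] using this
  have hlow : ∀ t ∈ Set.Ioc (0 : ℝ) 1, h b - h a ≤ slope (fun t : ℝ => h (a + t • (b - a))) 0 t := by
    intro t ht
    have := hc.2 (Set.mem_univ a) (Set.mem_univ b) (sub_nonneg.2 ht.2) ht.1.le (by ring)
    have e : (1 - t) • a + t • b = a + t • (b - a) := by module
    rw [e, smul_eq_mul, smul_eq_mul] at this
    rw [slope_def_field]
    simp only [zero_smul, add_zero, sub_zero]
    rw [le_div_iff₀ ht.1]
    linarith
  have hten := hasDerivAt_iff_tendsto_slope.1 hline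
  have hten' := hten.mono_left (nhdsWithin_mono 0 (fun t (ht : 0 < t) => ht.ne') :
    𝓝[>] (0 : ℝ) ≤ _)
  have : h b - h a ≤ 0 := ge_of_tendsto hten' <| by
    filter_upwards [Ioc_mem_nhdsGT (zero_lt_one' ℝ)] with t ht using hlow t ht
  linarith

theorem Lag_le_of_gradyL_eq_zero (hf : ContDiff ℝ 2
    (fun p : EuclideanSpace ℝ (Fin n) × EuclideanSpace ℝ (Fin m) => f p.1 p.2))
    (hg : ∀ i, ContDiff ℝ 2
      (fun p : EuclideanSpace ℝ (Fin n) × EuclideanSpace ℝ (Fin m) => g p.1 p.2 i))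
    {x : EuclideanSpace ℝ (Fin n)} (hfx : ConcaveOn ℝ Set.univ (f x))
    (hgx : ∀ i, ConvexOn ℝ Set.univ (fun y => g x y i)) {y : EuclideanSpace ℝ (Fin m)}
    {lam : Fin q → ℝ} (hlam : ∀ i, 0 ≤ lam i) (h0 : gradyL f g x y lam = 0)
    (y' : EuclideanSpace ℝ (Fin m)) : Lag f g x y' lam ≤ Lag f g x y lam := by
  have hsum : ConvexOn ℝ Set.univ (fun y => ∑ i, lam i * g x y i) := by
    refine ⟨convex_univ, fun a _ b _ s t hs ht hst => ?_⟩
    simp only [smul_eq_mul, Finset.mul_sum, ← Finset.sum_add_distrib]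
    refine Finset.sum_le_sum fun i _ => ?_
    have := (hgx i).2 (Set.mem_univ a) (Set.mem_univ b) hs ht hst
    simp only [smul_eq_mul] at this
    nlinarith [mul_le_mul_of_nonneg_left this (hlam i)]
  have hconc : ConcaveOn ℝ Set.univ (fun y => Lag f g x y lam) := hfx.sub hsum
  have hdiff : DifferentiableAt ℝ (fun y => Lag f g x y lam) y := by
    refine (differentiableAt_right_of_contDiff hf x y).sub
      (DifferentiableAt.fun_sum fun i _ => ?_)
    exact (differentiableAt_right_of_contDiff (φ := fun x y => g x y i) (hg i) x y).const_mul _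
  refine hconc.le_of_fderiv_eq_zero hdiff ?_ y'
  simpa [gradyL, grady, gradient] using h0

theorem Vfun_le_Lag (hf : ContDiff ℝ 2
    (fun p : EuclideanSpace ℝ (Fin n) × EuclideanSpace ℝ (Fin m) => f p.1 p.2))
    (hg : ∀ i, ContDiff ℝ 2
      (fun p : EuclideanSpace ℝ (Fin n) × EuclideanSpace ℝ (Fin m) => g p.1 p.2 i))
    {x : EuclideanSpace ℝ (Fin n)} (hfx : ConcaveOn ℝ Set.univ (f x))
    (hgx : ∀ i, ConvexOn ℝ Set.univ (fun y => g x y i)) {y : EuclideanSpace ℝ (Fin m)}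
    {lam : Fin q → ℝ} (hlam : ∀ i, 0 ≤ lam i) (h0 : gradyL f g x y lam = 0) :
    Vfun f g x ≤ (Lag f g x y lam : EReal) := by
  refine sSup_le ?_
  rintro _ ⟨y', hy', rfl⟩
  rw [EReal.coe_le_coe_iff]
  refine le_trans ?_ (Lag_le_of_gradyL_eq_zero hf hg hfx hgx hlam h0 y')
  have : ∑ i, lam i * g x y' i ≤ 0 :=
    Finset.sum_nonpos fun i _ => mul_nonpos_of_nonneg_of_nonpos (hlam i) (hy' i)
  unfold Lag
  linarith

theorem Lag_eq_of_mem_SigmaSet {x : EuclideanSpace ℝ (Fin n)} {y : EuclideanSpace ℝ (Fin m)}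
    {lam : Fin q → ℝ} (h : lam ∈ SigmaSet f g x y) : Lag f g x y lam = f x y := by
  simp [Lag, h.2.2.2]

theorem Vfun_eq_of_mem_SigmaSet (hf : ContDiff ℝ 2
    (fun p : EuclideanSpace ℝ (Fin n) × EuclideanSpace ℝ (Fin m) => f p.1 p.2))
    (hg : ∀ i, ContDiff ℝ 2
      (fun p : EuclideanSpace ℝ (Fin n) × EuclideanSpace ℝ (Fin m) => g p.1 p.2 i))
    {x : EuclideanSpace ℝ (Fin n)} (hfx : ConcaveOn ℝ Set.univ (f x))
    (hgx : ∀ i, ConvexOn ℝ Set.univ (fun y => g x y i)) {y : EuclideanSpace ℝ (Fin m)}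
    {lam : Fin q → ℝ} (h : lam ∈ SigmaSet f g x y) : Vfun f g x = (f x y : EReal) := by
  refine le_antisymm ?_ (le_sSup ⟨y, h.2.2.1, rfl⟩)
  rw [← Lag_eq_of_mem_SigmaSet h]
  exact Vfun_le_Lag hf hg hfx hgx h.2.1 h.1

theorem SigmaSet_eq_MultSetP (hf : ContDiff ℝ 2
    (fun p : EuclideanSpace ℝ (Fin n) × EuclideanSpace ℝ (Fin m) => f p.1 p.2))
    (hg : ∀ i, ContDiff ℝ 2
      (fun p : EuclideanSpace ℝ (Fin n) × EuclideanSpace ℝ (Fin m) => g p.1 p.2 i))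
    (x : EuclideanSpace ℝ (Fin n)) (y : EuclideanSpace ℝ (Fin m)) :
    SigmaSet f g x y = MultSetP g (grady f x y) x y := by
  ext lam
  simp only [SigmaSet, MultSetP, Set.mem_ofPred_eq, gradyL_eq hf hg]
  tauto

theorem mem_SigmaSet_of_tendsto (hf : ContDiff ℝ 2
    (fun p : EuclideanSpace ℝ (Fin n) × EuclideanSpace ℝ (Fin m) => f p.1 p.2))
    (hg : ∀ i, ContDiff ℝ 2
      (fun p : EuclideanSpace ℝ (Fin n) × EuclideanSpace ℝ (Fin m) => g p.1 p.2 i))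
    {xk : ℕ → EuclideanSpace ℝ (Fin n)} {yk : ℕ → EuclideanSpace ℝ (Fin m)}
    {lamk : ℕ → Fin q → ℝ} {x : EuclideanSpace ℝ (Fin n)} {y : EuclideanSpace ℝ (Fin m)}
    {lam : Fin q → ℝ} (hx : Tendsto xk atTop (𝓝 x)) (hy : Tendsto yk atTop (𝓝 y))
    (hl : Tendsto lamk atTop (𝓝 lam)) (h : ∀ k, lamk k ∈ SigmaSet f g (xk k) (yk k)) :
    lam ∈ SigmaSet f g x y := by
  have hli : ∀ i, Tendsto (fun k => lamk k i) atTop (𝓝 (lam i)) := tendsto_pi_nhds.1 hl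
  have hgi : ∀ i, Tendsto (fun k => g (xk k) (yk k) i) atTop (𝓝 (g x y i)) := fun i =>
    ((hg i).continuous.tendsto (x, y)).comp (hx.prodMk_nhds hy)
  refine ⟨?_, fun i => ?_, fun i => ?_, ?_⟩
  · have := ((contDiff_gradyL hf hg).continuous.tendsto (x, y, lam)).comp
      (hx.prodMk_nhds (hy.prodMk_nhds hl))
    exact tendsto_nhds_unique this (tendsto_const_nhds.congr fun k => (h k).1.symm)
  · exact ge_of_tendsto' (hli i) fun k => (h k).2.1 i
  · exact le_of_tendsto' (hgi i) fun k => (h k).2.2.1 i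
  · have := tendsto_finsetSum Finset.univ fun i _ => (hli i).mul (hgi i)
    exact tendsto_nhds_unique this (tendsto_const_nhds.congr fun k => (h k).2.2.2.symm)

end Duality

section Variational

/-- A point of a closed set that is a Fréchet-type minimizer, up to a linear term, is a limit of
exact local minimizers of smooth perturbations. -/
theorem exists_isLocalMinOn_near {W X : Type*} [NormedAddCommGroup W] [NormedSpace ℝ W]
    [FiniteDimensional ℝ W] [NormedAddCommGroup X] [InnerProductSpace ℝ X]
    {F : W → ℝ} (hF : ContDiff ℝ 1 F) {Z : Set W} (hZ : IsClosed Z) {w₀ : W} (hw₀ : w₀ ∈ Z)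
    (A : W →L[ℝ] X) (v : X)
    (hmin : ∀ ε : ℝ, 0 < ε → ∃ δ : ℝ, 0 < δ ∧ ∀ w ∈ Z, ‖w - w₀‖ < δ →
      F w₀ + ⟪v, A (w - w₀)⟫ - ε * ‖A (w - w₀)‖ ≤ F w) {η : ℝ} (hη : 0 < η) :
    ∃ (θ : W → ℝ) (w : W), ContDiff ℝ 1 θ ∧ w ∈ Z ∧ ‖w - w₀‖ < η ∧ IsLocalMinOn θ Z w ∧
      ‖fderiv ℝ θ w - (fderiv ℝ F w - (innerSL ℝ v).comp A)‖ ≤ η := by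
  set T := toEuclidean (E := W)
  set T' : W →L[ℝ] EuclideanSpace ℝ (Fin (Module.finrank ℝ W)) :=
    T.toContinuousLinearMap
  set c := ‖(T.symm : EuclideanSpace ℝ (Fin (Module.finrank ℝ W)) →L[ℝ] W)‖
  have hc : 0 ≤ c := norm_nonneg _
  have hcT : ∀ w, ‖w‖ ≤ c * ‖T' w‖ := fun w => by
    simpa [T'] using
      (T.symm : EuclideanSpace ℝ (Fin (Module.finrank ℝ W)) →L[ℝ] W).le_opNorm (T w)
  set ε := η / (4 * (‖A‖ + 1))
  have hA := norm_nonneg A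
  have hT := norm_nonneg T'
  have hε : 0 < ε := by positivity
  obtain ⟨δ, hδ, hm⟩ := hmin ε hε
  set ρ := min (δ / 2) η
  have hρ : 0 < ρ := by positivity
  set κ := ρ / (c + 4 * ‖T'‖ + 1)
  have hκ : 0 < κ := by positivity
  have hκρ : κ * (c + 4 * ‖T'‖ + 1) = ρ := div_mul_cancel₀ _ (by positivity)
  set r := κ ^ 2 / (4 * ε)
  have hr : 0 < r := by positivity
  set θ : W → ℝ := fun w => F w - ⟪v, A w⟫ + ε / (2 * r) * ‖A (w - w₀)‖ ^ 2 + ‖T' (w - w₀)‖ ^ 2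
  have hθ : ContDiff ℝ 1 θ := by
    refine ((hF.sub ((innerSL ℝ v).contDiff.comp A.contDiff)).add
      (contDiff_const.mul (ContDiff.norm_sq ℝ ?_))).add (ContDiff.norm_sq ℝ ?_)
    · exact A.contDiff.comp (contDiff_id.sub contDiff_const)
    · exact T'.contDiff.comp (contDiff_id.sub contDiff_const)
  obtain ⟨w, ⟨hwZ, hwb⟩, hwmin⟩ := ((isCompact_closedBall w₀ ρ).inter_left hZ).exists_isMinOn
    ⟨w₀, hw₀, mem_closedBall_self hρ.le⟩ hθ.continuous.continuousOn
  have hwρ : ‖w - w₀‖ ≤ ρ := by simpa [dist_eq_norm] using hwb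
  have h1 : θ w ≤ θ w₀ := hwmin ⟨hw₀, mem_closedBall_self hρ.le⟩
  have h2 := hm w hwZ (by have : ρ ≤ δ / 2 := min_le_left _ _
                          linarith)
  set s := ‖A (w - w₀)‖
  have hs : 0 ≤ s := norm_nonneg _
  have h3 : ε / (2 * r) * s ^ 2 + ‖T' (w - w₀)‖ ^ 2 ≤ ε * s := by
    simp only [θ, sub_self, map_zero, norm_zero] at h1
    rw [map_sub, inner_sub_right] at h2
    rw [show ‖A (w - w₀)‖ = s from rfl] at h1
    linarith
  have hsr : s ≤ 2 * r := by
    by_contra! hlt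
    have h4 : ε / (2 * r) * s ^ 2 ≤ ε * s := by nlinarith [sq_nonneg ‖T' (w - w₀)‖]
    have h5 : ε / (2 * r) * s ^ 2 = ε * s * (s / (2 * r)) := by field_simp
    have h6 : 1 < s / (2 * r) := by rwa [one_lt_div (by positivity)]
    have h7 : 0 < ε * s := mul_pos hε (by linarith)
    nlinarith
  have hTκ : ‖T' (w - w₀)‖ < κ := by
    have h4 : 0 ≤ ε / (2 * r) * s ^ 2 := by positivity
    have h5 : ε * s ≤ κ ^ 2 / 2 := by
      calc ε * s ≤ ε * (2 * r) := by gcongr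
        _ = κ ^ 2 / 2 := by simp only [r]; field_simp; norm_num
    have h6 : 0 < κ ^ 2 := by positivity
    exact lt_of_pow_lt_pow_left₀ 2 hκ.le (by linarith)
  have hwlt : ‖w - w₀‖ < ρ := by
    have := hcT (w - w₀)
    have : c * ‖T' (w - w₀)‖ ≤ c * κ := by gcongr
    nlinarith
  refine ⟨θ, w, hθ, hwZ, hwlt.trans_le (min_le_right _ _), ?_, ?_⟩
  · have hnhds : ball w₀ ρ ∈ 𝓝 w := isOpen_ball.mem_nhds (by simpa [dist_eq_norm] using hwlt)
    filter_upwards [inter_mem_nhdsWithin Z hnhds] with z hz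
    exact hwmin ⟨hz.1, ball_subset_closedBall hz.2⟩
  · have hdA : HasFDerivAt (fun z => A (z - w₀)) A w :=
      A.hasFDerivAt.comp w ((hasFDerivAt_id w).sub_const w₀)
    have hdT : HasFDerivAt (fun z => T' (z - w₀)) T' w :=
      T'.hasFDerivAt.comp w ((hasFDerivAt_id w).sub_const w₀)
    have hd : HasFDerivAt θ (fderiv ℝ F w - (innerSL ℝ v).comp A +
        (ε / (2 * r)) • (2 • (innerSL ℝ (A (w - w₀))).comp A) +
        2 • (innerSL ℝ (T' (w - w₀))).comp T') w := by
      refine ((((hF.differentiable (by norm_num)) w).hasFDerivAt.sub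
        ((innerSL ℝ v).hasFDerivAt.comp w A.hasFDerivAt)).add
        (hdA.norm_sq.const_mul _)).add hdT.norm_sq
    rw [hd.fderiv]
    have e : fderiv ℝ F w - (innerSL ℝ v).comp A +
        (ε / (2 * r)) • (2 • (innerSL ℝ (A (w - w₀))).comp A) +
        2 • (innerSL ℝ (T' (w - w₀))).comp T' - (fderiv ℝ F w - (innerSL ℝ v).comp A) =
        (ε / r) • (innerSL ℝ (A (w - w₀))).comp A +
        (2 : ℝ) • (innerSL ℝ (T' (w - w₀))).comp T' := by
      have : (ε / r) = (ε / (2 * r)) * 2 := by field_simp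
      rw [this]
      module
    rw [e]
    refine (norm_add_le _ _).trans ?_
    rw [norm_smul, norm_smul, Real.norm_of_nonneg (by positivity), Real.norm_of_nonneg (by norm_num)]
    have b1 : ‖(innerSL ℝ (A (w - w₀))).comp A‖ ≤ 2 * r * ‖A‖ := by
      refine (ContinuousLinearMap.opNorm_comp_le _ _).trans ?_
      rw [innerSL_apply_norm]
      gcongr
    have b2 : ‖(innerSL ℝ (T' (w - w₀))).comp T'‖ ≤ κ * ‖T'‖ := by
      refine (ContinuousLinearMap.opNorm_comp_le _ _).trans ?_
      rw [innerSL_apply_norm]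
      gcongr
    have b3 : ε / r * ‖(innerSL ℝ (A (w - w₀))).comp A‖ ≤ η / 2 := by
      calc ε / r * ‖(innerSL ℝ (A (w - w₀))).comp A‖ ≤ ε / r * (2 * r * ‖A‖) := by gcongr
        _ = 2 * ε * ‖A‖ := by field_simp
        _ ≤ 2 * ε * (‖A‖ + 1) := by gcongr; linarith
        _ = η / 2 := by simp only [ε]; field_simp; norm_num
    have b4 : κ * (4 * ‖T'‖) ≤ η := by
      have : ρ ≤ η := min_le_right _ _
      nlinarith
    linarith

/-- A continuous function whose proximal subgradients are bounded by `K` on a ball satisfies a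
Lipschitz estimate with any larger constant, up to a quadratic error. -/
theorem exists_quadratic_lipschitz_bound {X : Type*} [NormedAddCommGroup X]
    [InnerProductSpace ℝ X] [FiniteDimensional ℝ X] {ψ : X → ℝ} {x₀ : X} {R K : ℝ} (hR : 0 < R)
    (hK : 0 ≤ K) (hψ : ContinuousOn ψ (closedBall x₀ R))
    (hsub : ∀ z ∈ ball x₀ R, ∀ (v : X) (D : ℝ),
      (∀ᶠ w in 𝓝 z, ψ z + ⟪v, w - z⟫ - D * ‖w - z‖ ^ 2 ≤ ψ w) → ‖v‖ ≤ K)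
    {K' : ℝ} (hKK' : K < K') :
    ∃ C : ℝ, 0 ≤ C ∧ ∀ x ∈ ball x₀ (R / 2), ∀ x' ∈ ball x₀ (R / 2),
      ψ x' ≤ ψ x + K' * ‖x - x'‖ + C * ‖x - x'‖ ^ 2 := by
  obtain ⟨M, hM⟩ := (isCompact_closedBall x₀ R).exists_bound_of_continuousOn hψ
  have hM0 : 0 ≤ M := (norm_nonneg _).trans (hM x₀ (mem_closedBall_self hR.le))
  set C := (2 * M + 1) / (R / 2) ^ 2
  have hC : 0 < C := by positivity
  have hCR : C * (R / 2) ^ 2 = 2 * M + 1 := div_mul_cancel₀ _ (by positivity)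
  refine ⟨C, hC.le, fun x hx x' hx' => ?_⟩
  have hsubset : ball x₀ (R / 2) ⊆ closedBall x₀ R :=
    (ball_subset_ball (by linarith)).trans ball_subset_closedBall
  set p : X → ℝ := fun z => ψ z + K' * ‖z - x'‖ + C * ‖z - x'‖ ^ 2
  obtain ⟨z, hz, hzmin⟩ := (isCompact_closedBall x₀ R).exists_isMinOn
    ⟨x', hsubset hx'⟩ (f := p)
    ((hψ.add (by fun_prop)).add (by fun_prop))
  suffices hzx : z = x' by
    have := hzmin (hsubset hx)
    simpa [p, hzx] using this
  by_contra hne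
  set a := ‖z - x'‖
  have ha : 0 < a := norm_pos_iff.2 (sub_ne_zero.2 hne)
  have hK' : 0 < K' := hK.trans_lt hKK'
  have haR : a < R / 2 := by
    have h1 : p z ≤ p x' := hzmin (hsubset hx')
    simp only [p, sub_self, norm_zero] at h1
    have h2 := abs_le.1 (hM z hz)
    have h3 := abs_le.1 (hM x' (hsubset hx'))
    have h4 : C * a ^ 2 < C * (R / 2) ^ 2 := by
      have : 0 < K' * a := by positivity
      rw [hCR]
      norm_num at h1
      linarith
    exact lt_of_pow_lt_pow_left₀ 2 (by positivity) (lt_of_mul_lt_mul_left h4 hC.le)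
  have hzb : z ∈ ball x₀ R := by
    have h1 : dist z x' = a := dist_eq_norm _ _
    have h2 := dist_triangle z x' x₀
    rw [mem_ball] at hx' ⊢
    linarith
  set b := K' / (2 * a) + C
  have hb : 0 < b := by positivity
  have hv := hsub z hzb (-(2 * b) • (z - x')) b <| by
    filter_upwards [isOpen_ball.mem_nhds hzb] with w hw
    have h1 : p z ≤ p w := hzmin (ball_subset_closedBall hw)
    simp only [p] at h1
    have h2 : ‖w - x'‖ ^ 2 = a ^ 2 + 2 * ⟪z - x', w - z⟫ + ‖w - z‖ ^ 2 := by
      rw [← norm_add_sq_real]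
      congr 2
      abel
    have h3 : K' * ‖w - x'‖ - K' * a ≤ K' / (2 * a) * (‖w - x'‖ ^ 2 - a ^ 2) := by
      have : K' / (2 * a) * (‖w - x'‖ ^ 2 - a ^ 2) - (K' * ‖w - x'‖ - K' * a) =
          K' / (2 * a) * (‖w - x'‖ - a) ^ 2 := by field_simp; ring
      have h4 : 0 ≤ K' / (2 * a) * (‖w - x'‖ - a) ^ 2 := by positivity
      linarith
    rw [real_inner_smul_left]
    have h5 : b * (‖w - x'‖ ^ 2 - a ^ 2) = K' / (2 * a) * (‖w - x'‖ ^ 2 - a ^ 2) +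
      C * ‖w - x'‖ ^ 2 - C * a ^ 2 := by simp only [b]; ring
    rw [h2] at h5 h3
    rw [h2] at h1
    nlinarith
  rw [norm_smul, norm_neg, Real.norm_of_nonneg (by positivity)] at hv
  have : 2 * b * a = K' + 2 * C * a := by simp only [b]; field_simp
  have h6 : 0 < C * a := by positivity
  change 2 * b * a ≤ K at hv
  linarith

/-- Proximal subgradients are Fréchet subgradients. -/
theorem mem_FSub_of_proximal {φ : EuclideanSpace ℝ (Fin n) → EReal} {z v : EuclideanSpace ℝ (Fin n)}
    {D : ℝ} (hfin : ∀ᶠ w in 𝓝 z, φ w = ((φ w).toReal : EReal))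
    (h : ∀ᶠ w in 𝓝 z, (φ z).toReal + ⟪v, w - z⟫ - D * ‖w - z‖ ^ 2 ≤ (φ w).toReal) :
    v ∈ FSub φ z := by
  refine ⟨_, hfin.self_of_nhds, fun ε hε => ?_⟩
  obtain ⟨δ, hδ, hball⟩ := Metric.eventually_nhds_iff.1 (hfin.and h)
  refine ⟨min δ (ε / (|D| + 1)), by positivity, fun w hw => ?_⟩
  obtain ⟨h1, h2⟩ := hball (y := w) (by
    rw [dist_eq_norm]
    exact hw.trans_le (min_le_left _ _))
  rw [h1, EReal.coe_le_coe_iff]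
  have h3 : ‖w - z‖ * (|D| + 1) < ε :=
    (lt_div_iff₀ (by positivity)).1 (hw.trans_le (min_le_right _ _))
  have h4 := norm_nonneg (w - z)
  have h5 : D * ‖w - z‖ ^ 2 ≤ ε * ‖w - z‖ := by
    have : D * ‖w - z‖ ≤ ε := by nlinarith [le_abs_self D]
    nlinarith
  linarith

theorem exists_quadratic_lipschitz_bound_of_FSub {φ : EuclideanSpace ℝ (Fin n) → EReal}
    {xb : EuclideanSpace ℝ (Fin n)} {R K : ℝ}
    (hR : 0 < R) (hK : 0 ≤ K) (hfin : ∀ x ∈ ball xb R, φ x = ((φ x).toReal : EReal))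
    (hcts : ContinuousOn (fun x => (φ x).toReal) (ball xb R)) (ζ : EuclideanSpace ℝ (Fin n))
    (hsub : ∀ x ∈ ball xb R, ∀ v ∈ FSub φ x, ‖v - ζ‖ ≤ K) {K' : ℝ} (hK' : K < K') :
    ∃ C r : ℝ, 0 ≤ C ∧ 0 < r ∧ r ≤ R ∧ ∀ x ∈ ball xb r, ∀ x' ∈ ball xb r,
      |(φ x).toReal - (φ x').toReal - ⟪ζ, x - x'⟫| ≤ K' * ‖x - x'‖ + C * ‖x - x'‖ ^ 2 := by
  have hsubset : closedBall xb (R / 2) ⊆ ball xb R := closedBall_subset_ball (by linarith)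
  obtain ⟨C, hC, hbound⟩ := exists_quadratic_lipschitz_bound (x₀ := xb) (R := R / 2)
    (ψ := fun x => (φ x).toReal - ⟪ζ, x⟫) (by positivity) hK
    ((hcts.mono hsubset).sub (by fun_prop)) (fun z hz v D hv => by
      have hz' := hsubset (ball_subset_closedBall hz)
      have h1 := hsub z hz' (v + ζ) <| mem_FSub_of_proximal (D := D)
        (by filter_upwards [isOpen_ball.mem_nhds hz'] with w hw using hfin w hw) <| by
          filter_upwards [hv] with w hw
          rw [inner_add_left, inner_sub_right ζ]
          linarith
      simpa using h1) hK'
  refine ⟨C, R / 2 / 2, hC, by positivity, by linarith, fun x hx x' hx' => abs_le.2 ⟨?_, ?_⟩⟩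
  · have := hbound x hx x' hx'
    rw [inner_sub_right]
    linarith
  · have := hbound x' hx' x hx
    rw [norm_sub_rev] at this
    rw [inner_sub_right]
    linarith

end Variational

section WolfeSystem

variable (hf : ContDiff ℝ 2
    (fun p : EuclideanSpace ℝ (Fin n) × EuclideanSpace ℝ (Fin m) => f p.1 p.2))
  (hg : ∀ i, ContDiff ℝ 2
    (fun p : EuclideanSpace ℝ (Fin n) × EuclideanSpace ℝ (Fin m) => g p.1 p.2 i))

theorem wolfe_feasible_iff
    {w : EuclideanSpace ℝ (Fin n) × EuclideanSpace ℝ (Fin m) × (Fin q → ℝ)} :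
    ((∀ i, WolfeG n m q w i ≤ 0) ∧ ∀ j, WolfeH f g w j = 0) ↔
      (∀ i, 0 ≤ w.2.2 i) ∧ gradyL f g w.1 w.2.1 w.2.2 = 0 := by
  refine and_congr (by simp [WolfeG]) ⟨fun h => ?_, fun h j => by simp [WolfeH, h]⟩
  ext j
  exact h j

include hf hg

theorem isClosed_wolfe_feasible :
    IsClosed {w : EuclideanSpace ℝ (Fin n) × EuclideanSpace ℝ (Fin m) × (Fin q → ℝ) |
      (∀ i, WolfeG n m q w i ≤ 0) ∧ ∀ j, WolfeH f g w j = 0} := by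
  simp only [wolfe_feasible_iff, Set.ofPred_and, Set.ofPred_forall]
  refine (isClosed_iInter fun i => isClosed_le continuous_const (by fun_prop)).inter
    (isClosed_eq (contDiff_gradyL hf hg).continuous continuous_const)

theorem mem_XiSet_of_mem_MultSetW {x : EuclideanSpace ℝ (Fin n)} {y : EuclideanSpace ℝ (Fin m)}
    {lam : Fin q → ℝ} (hlam : ∀ i, 0 ≤ lam i) (h0 : gradyL f g x y lam = 0) {t : ℝ}
    {v : EuclideanSpace ℝ (Fin n)} {a : Fin q → ℝ} {μ : Fin m → ℝ}
    (h : (a, μ) ∈ MultSetW (WolfeG n m q) (WolfeH f g)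
      (-(t • fderiv ℝ (fun w : EuclideanSpace ℝ (Fin n) × EuclideanSpace ℝ (Fin m) × (Fin q → ℝ) =>
        Lag f g w.1 w.2.1 w.2.2) (x, y, lam) -
        (innerSL ℝ v).comp (ContinuousLinearMap.fst ℝ _ _))) (x, y, lam)) :
    ∃ u ∈ XiSet t f g x y lam, v = t • gradxL f g x y lam + hessxyLu f g x y lam u := by
  obtain ⟨ha, heq, hcomp⟩ := h
  set u : EuclideanSpace ℝ (Fin m) := WithLp.toLp 2 μ
  set N : EuclideanSpace ℝ (Fin n) × EuclideanSpace ℝ (Fin m) × (Fin q → ℝ) → ℝ :=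
    fun w => ⟪gradyL f g w.1 w.2.1 w.2.2, u⟫
  set Λ : EuclideanSpace ℝ (Fin n) × EuclideanSpace ℝ (Fin m) × (Fin q → ℝ) → ℝ :=
    fun w => Lag f g w.1 w.2.1 w.2.2
  have hΛ : DifferentiableAt ℝ Λ (x, y, lam) :=
    (contDiff_Lag hf hg).differentiable (by norm_num) _
  have hgr := (contDiff_gradyL hf hg).differentiable (by norm_num) (x, y, lam)
  have hN : DifferentiableAt ℝ N (x, y, lam) := hgr.inner ℝ (differentiableAt_const u)
  have hG : ∀ i, fderiv ℝ (fun w => WolfeG n m q w i) (x, y, lam) =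
      -((ContinuousLinearMap.proj i).comp ((ContinuousLinearMap.snd ℝ _ _).comp
        (ContinuousLinearMap.snd ℝ _ _))) := fun i =>
    ContinuousLinearMap.fderiv (-((ContinuousLinearMap.proj (R := ℝ) (φ := fun _ : Fin q => ℝ) i).comp
      ((ContinuousLinearMap.snd ℝ (EuclideanSpace ℝ (Fin m)) (Fin q → ℝ)).comp
        (ContinuousLinearMap.snd ℝ (EuclideanSpace ℝ (Fin n)) _))))
  have hH : ∑ j, μ j • fderiv ℝ (fun w => WolfeH f g w j) (x, y, lam) =
      fderiv ℝ N (x, y, lam) := by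
    have hNe : N = fun w => ∑ j, μ j * WolfeH f g w j := by
      funext w
      simp [N, WolfeH, u, PiLp.inner_apply]
    rw [hNe]
    refine (HasFDerivAt.fun_sum fun j _ => HasFDerivAt.const_mul ?_ (μ j)).fderiv.symm
    exact ((differentiableAt_euclidean.1 hgr) j).hasFDerivAt
  have happ : ∀ d : EuclideanSpace ℝ (Fin n) × EuclideanSpace ℝ (Fin m) × (Fin q → ℝ),
      -(t * fderiv ℝ Λ (x, y, lam) d - ⟪v, d.1⟫) + ∑ i, a i * d.2.2 i -
        fderiv ℝ N (x, y, lam) d = 0 := by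
    intro d
    have := congrArg (fun T => T d) heq
    simp only [hG, hH] at this
    simpa using this
  have hx : ∀ d, ⟪v, d⟫ = ⟪t • gradxL f g x y lam + hessxyLu f g x y lam u, d⟫ := by
    intro d
    have h1 : ⟪gradxL f g x y lam, d⟫ = fderiv ℝ Λ (x, y, lam) (d, 0, 0) :=
      inner_gradient_fst hΛ d
    have h2 : ⟪hessxyLu f g x y lam u, d⟫ = fderiv ℝ N (x, y, lam) (d, 0, 0) :=
      inner_gradient_fst hN d
    have h3 := happ (d, 0, 0)
    rw [← h1, ← h2] at h3
    rw [inner_add_left, real_inner_smul_left]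
    simp at h3
    linarith
  have hy : ∀ d, ⟪hessyyLu f g x y lam u, d⟫ = ⟪(0 : EuclideanSpace ℝ (Fin m)), d⟫ := by
    intro d
    have h1 : ⟪gradyL f g x y lam, d⟫ = fderiv ℝ Λ (x, y, lam) (0, d, 0) :=
      inner_gradient_snd hΛ d
    have h2 : ⟪hessyyLu f g x y lam u, d⟫ = fderiv ℝ N (x, y, lam) (0, d, 0) :=
      inner_gradient_snd hN d
    have h3 := happ (0, d, 0)
    rw [← h1, ← h2, h0] at h3
    rw [inner_zero_left]
    simp at h3
    linarith
  have hl : ∀ i, a i = -(gyTu g x y u i) - t * g x y i := by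
    intro i
    have hupd : ∀ (s : ℝ) (b : Fin q → ℝ),
        ∑ j, (lam + s • (Pi.single i 1 : Fin q → ℝ)) j * b j = ∑ j, lam j * b j + s * b i := by
      intro s b
      simp [add_mul, Finset.sum_add_distrib, Pi.single_apply]
    have h1 : fderiv ℝ Λ (x, y, lam) (0, 0, Pi.single i 1) = -g x y i := by
      refine fderiv_apply_of_affine hΛ fun s => ?_
      have := hupd s (g x y)
      simp only [Λ, Lag, Prod.smul_mk, Prod.mk_add_mk, smul_zero, add_zero]
      linarith
    have h2 : fderiv ℝ N (x, y, lam) (0, 0, Pi.single i 1) = -gyTu g x y u i := by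
      refine fderiv_apply_of_affine hN fun s => ?_
      have := hupd s (gyTu g x y u)
      simp only [N, Prod.smul_mk, Prod.mk_add_mk, smul_zero, add_zero, gradyL_eq hf hg,
        inner_sub_left, sum_inner, real_inner_smul_left]
      simp only [gyTu] at this ⊢
      linarith
    have h3 := happ (0, 0, Pi.single i 1)
    rw [h1, h2] at h3
    simp [Pi.single_apply] at h3
    linarith
  refine ⟨u, ⟨ext_inner_right ℝ hy, fun i => ?_, hlam, ?_⟩, ext_inner_right ℝ hx⟩
  · rw [← hl i]
    exact ha i
  · simp only [← hl]
    simp only [WolfeG, mul_neg, Finset.sum_neg_distrib, neg_eq_zero] at hcomp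
    simpa only [mul_comm] using hcomp

end WolfeSystem

section ValueFunction

variable (hf : ContDiff ℝ 2
    (fun p : EuclideanSpace ℝ (Fin n) × EuclideanSpace ℝ (Fin m) => f p.1 p.2))
  (hg : ∀ i, ContDiff ℝ 2
    (fun p : EuclideanSpace ℝ (Fin n) × EuclideanSpace ℝ (Fin m) => g p.1 p.2 i))
  {xb : EuclideanSpace ℝ (Fin n)}
  (hconv : ∃ δ : ℝ, 0 < δ ∧ ∀ x ∈ Metric.ball xb δ,
    ConcaveOn ℝ Set.univ (f x) ∧ ∀ i, ConvexOn ℝ Set.univ (fun y => g x y i))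
  (hrsc : RestrictedSupCompact f g xb)
  (hpcq : ∀ y ∈ Sol f g xb, StableParamCQ f g xb y)
  (hscq : ∀ y ∈ Sol f g xb, ∀ lam ∈ SigmaSet f g xb y,
    StableCQ (WolfeG n m q) (WolfeH f g) (xb, y, lam))
  (hcont : ContinuousAt (Vfun f g) xb)

include hf hg hrsc hpcq hcont

/-- Along a sequence of parameters, solutions and multipliers subconverge to a solution and a
multiplier of the limiting problem. -/
theorem exists_subseq_solution_multiplier {xk : ℕ → EuclideanSpace ℝ (Fin n)}
    (hx : Tendsto xk atTop (𝓝 xb)) :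
    ∃ (φ : ℕ → ℕ) (yk : ℕ → EuclideanSpace ℝ (Fin m)) (lamk : ℕ → Fin q → ℝ)
      (yb : EuclideanSpace ℝ (Fin m)) (lamb : Fin q → ℝ), StrictMono φ ∧
      (∀ k, yk k ∈ Sol f g (xk (φ k))) ∧ (∀ k, lamk k ∈ SigmaSet f g (xk (φ k)) (yk k)) ∧
      Tendsto yk atTop (𝓝 yb) ∧ Tendsto lamk atTop (𝓝 lamb) ∧ yb ∈ Sol f g xb ∧
      lamb ∈ SigmaSet f g xb yb := by
  obtain ⟨⟨c, hc⟩, ε, δ, hε, hδ, Ω, hΩ, hS⟩ := hrsc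
  have hVx : Tendsto (fun k => Vfun f g (xk k)) atTop (𝓝 (Vfun f g xb)) := hcont.tendsto.comp hx
  have hev : ∀ᶠ k in atTop, (Sol f g (xk k) ∩ Ω).Nonempty := by
    have h1 : Vfun f g xb - (ε : EReal) < Vfun f g xb := by
      rw [hc]
      exact_mod_cast sub_lt_self c hε
    filter_upwards [hVx.eventually (lt_mem_nhds h1), hx (ball_mem_nhds xb hδ)] with k h2 h3
    exact hS _ (by simpa [dist_eq_norm] using h3) h2
  obtain ⟨φ₁, hφ₁, hne⟩ := extraction_of_eventually_atTop hev
  choose y₁ hy₁ using hne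
  obtain ⟨yb, -, φ₂, hφ₂, hy₂⟩ := hΩ.tendsto_subseq fun k => (hy₁ k).2
  have hx₂ : Tendsto (fun k => xk (φ₁ (φ₂ k))) atTop (𝓝 xb) :=
    hx.comp (hφ₁.tendsto_atTop.comp hφ₂.tendsto_atTop)
  have hyb : yb ∈ Sol f g xb := by
    refine ⟨fun i => ?_, ?_⟩
    · exact le_of_tendsto' (((hg i).continuous.tendsto (xb, yb)).comp (hx₂.prodMk_nhds hy₂))
        fun k => (hy₁ (φ₂ k)).1.1 i
    · have h1 : Tendsto (fun k => (f (xk (φ₁ (φ₂ k))) (y₁ (φ₂ k)) : EReal)) atTop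
          (𝓝 (f xb yb : EReal)) :=
        (continuous_coe_real_ereal.tendsto _).comp
          ((hf.continuous.tendsto (xb, yb)).comp (hx₂.prodMk_nhds hy₂))
      refine tendsto_nhds_unique h1
        ((hVx.comp (hφ₁.tendsto_atTop.comp hφ₂.tendsto_atTop)).congr fun k => ?_)
      exact (hy₁ (φ₂ k)).1.2.symm
  obtain ⟨P, ⟨δ', hδ', hP⟩, hPmult, hstab⟩ := hpcq yb hyb
  have hev₂ : ∀ᶠ k in atTop, P (xk (φ₁ (φ₂ k))) (y₁ (φ₂ k)) := by
    filter_upwards [hx₂ (ball_mem_nhds xb hδ'), hy₂ (ball_mem_nhds yb hδ')] with k h1 h2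
    exact hP _ _ (hy₁ (φ₂ k)).1.1 (by simpa [dist_eq_norm] using h1)
      (by simpa [dist_eq_norm] using h2)
  obtain ⟨φ₃, hφ₃, hP₃⟩ := extraction_of_eventually_atTop hev₂
  have hx₃ := hx₂.comp hφ₃.tendsto_atTop
  have hy₃ := hy₂.comp hφ₃.tendsto_atTop
  obtain ⟨lamk, φ₄, lamb, hφ₄, hlamk, hlim, hlamb⟩ := hstab
    (fun k => grady f (xk (φ₁ (φ₂ (φ₃ k)))) (y₁ (φ₂ (φ₃ k)))) (fun k => xk (φ₁ (φ₂ (φ₃ k))))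
    (fun k => y₁ (φ₂ (φ₃ k))) (grady f xb yb)
    (((contDiff_grady hf).continuous.tendsto (xb, yb)).comp (hx₃.prodMk_nhds hy₃)) hx₃ hy₃ <| by
      intro k
      have hsol := (hy₁ (φ₂ (φ₃ k))).1
      refine hPmult _ _ (hP₃ k) hsol.1 (IsMaxOn.localize fun y' hy' => ?_)
      have h1 : (f (xk (φ₁ (φ₂ (φ₃ k)))) y' : EReal) ≤ f (xk (φ₁ (φ₂ (φ₃ k)))) (y₁ (φ₂ (φ₃ k))) := by
        rw [hsol.2]
        exact le_sSup ⟨y', hy', rfl⟩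
      exact EReal.coe_le_coe_iff.1 h1
  refine ⟨φ₁ ∘ φ₂ ∘ φ₃ ∘ φ₄, fun k => y₁ (φ₂ (φ₃ (φ₄ k))), lamk ∘ φ₄, yb, lamb,
    hφ₁.comp (hφ₂.comp (hφ₃.comp hφ₄)), fun k => (hy₁ _).1, fun k => ?_,
    hy₃.comp hφ₄.tendsto_atTop, hlim, hyb, ?_⟩
  · rw [SigmaSet_eq_MultSetP hf hg]
    exact hlamk _
  · rwa [SigmaSet_eq_MultSetP hf hg]

theorem exists_bounded_solution_multiplier :
    ∃ B δ : ℝ, 0 < δ ∧ ∀ x ∈ ball xb δ, ∃ y ∈ Sol f g x, ∃ lam ∈ SigmaSet f g x y,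
      ‖y‖ ≤ B ∧ ‖lam‖ ≤ B := by
  by_contra! hcon
  choose xk hxk hfail using fun k : ℕ =>
    hcon k (1 / ((k : ℝ) + 1)) Nat.one_div_pos_of_nat
  have hx : Tendsto xk atTop (𝓝 xb) :=
    tendsto_iff_dist_tendsto_zero.2 <| squeeze_zero (fun _ => dist_nonneg)
      (fun k => (mem_ball.1 (hxk k)).le) tendsto_one_div_add_atTop_nhds_zero_nat
  obtain ⟨φ, yk, lamk, yb, lamb, hφ, hyk, hlamk, hy, hl, -, -⟩ :=
    exists_subseq_solution_multiplier hf hg hrsc hpcq hcont hx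
  obtain ⟨M₁, hM₁⟩ := hy.norm.bddAbove_range
  obtain ⟨M₂, hM₂⟩ := hl.norm.bddAbove_range
  obtain ⟨k, hk⟩ := exists_nat_ge (max M₁ M₂)
  have hk' : (k : ℝ) ≤ φ k := by exact_mod_cast hφ.id_le k
  have h1 : ‖yk k‖ ≤ M₁ := hM₁ ⟨k, rfl⟩
  have h2 : ‖lamk k‖ ≤ M₂ := hM₂ ⟨k, rfl⟩
  have h3 := hfail (φ k) (yk k) (hyk k) (lamk k) (hlamk k)
    (h1.trans ((le_max_left _ _).trans (hk.trans hk')))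
  exact absurd (h2.trans ((le_max_right _ _).trans (hk.trans hk'))) (not_le.2 h3)

include hconv

theorem exists_ball_continuousOn_Vfun :
    ∃ R : ℝ, 0 < R ∧ (∀ x ∈ ball xb R, Vfun f g x = ((Vfun f g x).toReal : EReal)) ∧
      ContinuousOn (fun x => (Vfun f g x).toReal) (ball xb R) := by
  obtain ⟨B, δ₁, hδ₁, hB⟩ := exists_bounded_solution_multiplier hf hg hrsc hpcq hcont
  obtain ⟨δ₂, hδ₂, hcv⟩ := hconv
  refine ⟨min δ₁ δ₂, lt_min hδ₁ hδ₂, fun x hx => ?_, fun x hx => ?_⟩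
  · obtain ⟨y, hy, -⟩ := hB x (ball_subset_ball (min_le_left _ _) hx)
    rw [← hy.2, EReal.toReal_coe]
  · refine ContinuousAt.continuousWithinAt (tendsto_of_seq_tendsto fun s hs => ?_)
    refine tendsto_of_subseq_tendsto fun ns hns => ?_
    have hsn := hs.comp hns
    obtain ⟨φ₁, hφ₁, hball⟩ := extraction_of_eventually_atTop
      (hsn (isOpen_ball.mem_nhds (ball_subset_ball (min_le_left _ _) hx)))
    choose yk hyk lamk hlamk hyB hlB using fun k => hB _ (hball k)
    obtain ⟨y, -, φ₂, hφ₂, hy⟩ := tendsto_subseq_of_bounded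
      (isBounded_closedBall (x := (0 : EuclideanSpace ℝ (Fin m))) (r := B))
      (x := yk) fun k => by simpa using hyB k
    obtain ⟨lam, -, φ₃, hφ₃, hlam⟩ := tendsto_subseq_of_bounded
      (isBounded_closedBall (x := (0 : Fin q → ℝ)) (r := B))
      (x := lamk ∘ φ₂) fun k => by simpa using hlB (φ₂ k)
    have hy' := hy.comp hφ₃.tendsto_atTop
    have hx' := hsn.comp (hφ₁.tendsto_atTop.comp (hφ₂.tendsto_atTop.comp hφ₃.tendsto_atTop))
    have hmem : lam ∈ SigmaSet f g x y :=
      mem_SigmaSet_of_tendsto hf hg hx' hy' hlam fun k => hlamk (φ₂ (φ₃ k))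
    obtain ⟨hfx, hgx⟩ := hcv x (ball_subset_ball (min_le_right _ _) hx)
    refine ⟨φ₁ ∘ φ₂ ∘ φ₃, ?_⟩
    simp only [Function.comp_apply]
    rw [Vfun_eq_of_mem_SigmaSet hf hg hfx hgx hmem, EReal.toReal_coe]
    refine ((hf.continuous.tendsto (x, y)).comp (hx'.prodMk_nhds hy')).congr fun k => ?_
    have := (hyk (φ₂ (φ₃ k))).2
    simp only [Function.comp_apply] at this ⊢
    rw [← this, EReal.toReal_coe]

include hscq

/-- Limits of scaled Fréchet subgradients of the value function. -/
theorem exists_mem_XiSet_of_tendsto_FSub {xk vk : ℕ → EuclideanSpace ℝ (Fin n)} {tk : ℕ → ℝ}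
    {t : ℝ} {v : EuclideanSpace ℝ (Fin n)} (hx : Tendsto xk atTop (𝓝 xb))
    (hv : ∀ k, vk k ∈ FSub (Vfun f g) (xk k)) (ht₀ : ∀ k, 0 ≤ tk k)
    (ht : Tendsto tk atTop (𝓝 t)) (htv : Tendsto (fun k => tk k • vk k) atTop (𝓝 v)) :
    ∃ y ∈ Sol f g xb, ∃ lam ∈ SigmaSet f g xb y, ∃ u ∈ XiSet t f g xb y lam,
      v = t • gradxL f g xb y lam + hessxyLu f g xb y lam u := by
  obtain ⟨φ, yk, lamk, yb, lamb, hφ, hyk, hlamk, hy, hl, hyb, hlamb⟩ :=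
    exists_subseq_solution_multiplier hf hg hrsc hpcq hcont hx
  obtain ⟨δ₁, hδ₁, hcv⟩ := hconv
  obtain ⟨P, ⟨-, δ₂, hδ₂, hP⟩, hPmult, hstab⟩ := hscq yb hyb lamb hlamb
  set Z := {w : EuclideanSpace ℝ (Fin n) × EuclideanSpace ℝ (Fin m) × (Fin q → ℝ) |
      (∀ i, WolfeG n m q w i ≤ 0) ∧ ∀ j, WolfeH f g w j = 0} with hZdef
  set Λ : EuclideanSpace ℝ (Fin n) × EuclideanSpace ℝ (Fin m) × (Fin q → ℝ) → ℝ :=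
    fun w => Lag f g w.1 w.2.1 w.2.2
  have hΛ : ContDiff ℝ 1 Λ := contDiff_Lag hf hg
  set A := ContinuousLinearMap.fst ℝ (EuclideanSpace ℝ (Fin n))
    (EuclideanSpace ℝ (Fin m) × (Fin q → ℝ))
  set wb : EuclideanSpace ℝ (Fin n) × EuclideanSpace ℝ (Fin m) × (Fin q → ℝ) := (xb, yb, lamb)
  set wk : ℕ → EuclideanSpace ℝ (Fin n) × EuclideanSpace ℝ (Fin m) × (Fin q → ℝ) :=
    fun k => (xk (φ k), yk k, lamk k)
  have hxφ : Tendsto (fun k => xk (φ k)) atTop (𝓝 xb) := hx.comp hφ.tendsto_atTop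
  have hwk : Tendsto wk atTop (𝓝 wb) := hxφ.prodMk_nhds (hy.prodMk_nhds hl)
  have hlim0 := tendsto_one_div_add_atTop_nhds_zero_nat (𝕜 := ℝ)
  have hstep : ∀ᶠ k in atTop, ∃ w ∈ Z, ‖w - wk k‖ < 1 / ((k : ℝ) + 1) ∧
      ∃ β : EuclideanSpace ℝ (Fin n) × EuclideanSpace ℝ (Fin m) × (Fin q → ℝ) →L[ℝ] ℝ,
        ‖β - (fderiv ℝ Λ w - (innerSL ℝ (vk (φ k))).comp A)‖ ≤ 1 / ((k : ℝ) + 1) ∧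
        (MultSetW (WolfeG n m q) (WolfeH f g) (-β) w).Nonempty := by
    filter_upwards [hxφ (ball_mem_nhds xb hδ₁), hwk (ball_mem_nhds wb (half_pos hδ₂)),
      hlim0.eventually (gt_mem_nhds (half_pos hδ₂))] with k hk₁ hk₂ hk₃
    have hwZ : wk k ∈ Z := wolfe_feasible_iff.2 ⟨(hlamk k).2.1, (hlamk k).1⟩
    obtain ⟨c, hc, hsub⟩ := hv (φ k)
    have hcΛ : c = Λ (wk k) := by
      have h1 := (hyk k).2
      rw [hc, EReal.coe_eq_coe_iff] at h1
      rw [← h1]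
      exact (Lag_eq_of_mem_SigmaSet (hlamk k)).symm
    have hmin : ∀ ε : ℝ, 0 < ε → ∃ δ : ℝ, 0 < δ ∧ ∀ w ∈ Z, ‖w - wk k‖ < δ →
        Λ (wk k) + ⟪vk (φ k), A (w - wk k)⟫ - ε * ‖A (w - wk k)‖ ≤ Λ w := by
      intro ε hε
      obtain ⟨δ, hδ, hd⟩ := hsub ε hε
      obtain ⟨δ', hδ', hd'⟩ := Metric.isOpen_ball.mem_nhds hk₁ |> Metric.mem_nhds_iff.1
      refine ⟨min δ δ', lt_min hδ hδ', fun w hw hlt => ?_⟩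
      have hA : ‖w.1 - xk (φ k)‖ < min δ δ' := (norm_fst_le (w - wk k)).trans_lt hlt
      have h1 := hd w.1 (hA.trans_le (min_le_left _ _))
      obtain ⟨hfx, hgx⟩ := hcv w.1 (hd' (by
        rw [mem_ball, dist_eq_norm]
        exact hA.trans_le (min_le_right _ _)))
      have hw' := wolfe_feasible_iff.1 hw
      have h2 := h1.trans (Vfun_le_Lag hf hg hfx hgx hw'.1 hw'.2)
      rw [EReal.coe_le_coe_iff, hcΛ] at h2
      exact h2
    obtain ⟨θ, w, hθ, hw, hwlt, hloc, hβ⟩ := exists_isLocalMinOn_near hΛ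
      (isClosed_wolfe_feasible hf hg) hwZ A (vk (φ k)) hmin
      (Nat.one_div_pos_of_nat (n := k) (α := ℝ))
    refine ⟨w, hw, hwlt, fderiv ℝ θ w, hβ, ?_⟩
    have hPw : P w := by
      refine hP w hw.1 hw.2 ?_
      have h1 : ‖wk k - wb‖ < δ₂ / 2 := by simpa [dist_eq_norm] using hk₂
      have h2 := norm_sub_le_norm_sub_add_norm_sub w (wk k) wb
      linarith
    obtain ⟨a, μ, ha, heq, hcomp⟩ := hPmult w hPw hw.1 hw.2 θ hθ hloc
    refine ⟨(a, μ), ha, ?_, hcomp⟩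
    rw [← neg_eq_zero, ← heq]
    abel
  obtain ⟨φ₂, hφ₂, hall⟩ := extraction_of_eventually_atTop hstep
  choose w hwZ hwlt β hβ hmult using hall
  have hlim := hlim0.comp hφ₂.tendsto_atTop
  have hw : Tendsto w atTop (𝓝 wb) := by
    have h1 : Tendsto (fun k => w k - wk (φ₂ k)) atTop (𝓝 0) :=
      squeeze_zero_norm (fun k => (hwlt k).le) hlim
    simpa using h1.add (hwk.comp hφ₂.tendsto_atTop)
  have htφ := ht.comp (hφ.tendsto_atTop.comp hφ₂.tendsto_atTop)
  have htvφ := htv.comp (hφ.tendsto_atTop.comp hφ₂.tendsto_atTop)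
  have hβlim : Tendsto (fun k => -(tk (φ (φ₂ k)) • β k)) atTop
      (𝓝 (-(t • fderiv ℝ Λ wb - (innerSL ℝ v).comp A))) := by
    have h1 : Tendsto (fun k => β k - (fderiv ℝ Λ (w k) - (innerSL ℝ (vk (φ (φ₂ k)))).comp A))
        atTop (𝓝 0) := squeeze_zero_norm hβ hlim
    have h2 : Tendsto (fun k => fderiv ℝ Λ (w k)) atTop (𝓝 (fderiv ℝ Λ wb)) :=
      ((hΛ.continuous_fderiv (by norm_num)).tendsto wb).comp hw
    have h3 : Tendsto (fun k => (innerSL ℝ (tk (φ (φ₂ k)) • vk (φ (φ₂ k)))).comp A) atTop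
        (𝓝 ((innerSL ℝ v).comp A)) := by
      have h4 : Continuous fun z : EuclideanSpace ℝ (Fin n) => (innerSL ℝ z).comp A :=
        (innerSL ℝ).continuous.clm_comp continuous_const
      exact (h4.tendsto v).comp htvφ
    have h5 := ((htφ.smul h1).add ((htφ.smul h2).sub h3)).neg
    rw [smul_zero, zero_add] at h5
    refine h5.congr fun k => ?_
    simp only [Function.comp_apply, map_smul, ContinuousLinearMap.smul_comp]
    module
  obtain ⟨-, -, ⟨a, μ⟩, -, -, -, hlm⟩ := hstab _ w _ hβlim hw hwZ <| by
    intro k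
    obtain ⟨⟨a, μ⟩, ha, heq, hcomp⟩ := hmult k
    refine ⟨(tk (φ (φ₂ k)) • a, tk (φ (φ₂ k)) • μ), fun i => mul_nonneg (ht₀ _) (ha i), ?_, ?_⟩
    · have := congrArg (fun T => tk (φ (φ₂ k)) • T) heq
      simpa [smul_sub, Finset.smul_sum, mul_smul] using this
    · have := congrArg (fun s => tk (φ (φ₂ k)) * s) hcomp
      simpa [Finset.mul_sum, mul_assoc] using this
  obtain ⟨u, hu, hvu⟩ := mem_XiSet_of_mem_MultSetW hf hg hlamb.2.1 hlamb.1 hlm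
  exact ⟨yb, hyb, lamb, hlamb, u, hu, hvu⟩

theorem exists_bound_FSub
    (hzero : ∀ y ∈ Sol f g xb, ∀ lam ∈ SigmaSet f g xb y, ∀ u ∈ XiSet 0 f g xb y lam,
      hessxyLu f g xb y lam u = 0) :
    ∃ K δ : ℝ, 0 ≤ K ∧ 0 < δ ∧ ∀ x ∈ ball xb δ, ∀ v ∈ FSub (Vfun f g) x, ‖v‖ ≤ K := by
  by_contra! hcon
  choose xk hxk vk hvk hlt using fun k : ℕ =>
    hcon ((k : ℝ) + 1) (1 / ((k : ℝ) + 1)) (by positivity) Nat.one_div_pos_of_nat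
  have hx : Tendsto xk atTop (𝓝 xb) :=
    tendsto_iff_dist_tendsto_zero.2 <| squeeze_zero (fun _ => dist_nonneg)
      (fun k => (mem_ball.1 (hxk k)).le) tendsto_one_div_add_atTop_nhds_zero_nat
  have hpos : ∀ k, 0 < ‖vk k‖ := fun k => lt_trans (by positivity) (hlt k)
  have ht : Tendsto (fun k => ‖vk k‖⁻¹) atTop (𝓝 0) := by
    refine squeeze_zero (fun k => (inv_pos.2 (hpos k)).le) (fun k => ?_)
      (tendsto_one_div_add_atTop_nhds_zero_nat (𝕜 := ℝ))
    rw [one_div]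
    exact inv_anti₀ (by positivity) (hlt k).le
  obtain ⟨v, hv, φ, hφ, hlim⟩ := (isCompact_sphere (0 : EuclideanSpace ℝ (Fin n)) 1).tendsto_subseq
    (x := fun k => ‖vk k‖⁻¹ • vk k) fun k => by
      rw [mem_sphere_zero_iff_norm, norm_smul, norm_inv, norm_norm, inv_mul_cancel₀ (hpos k).ne']
  obtain ⟨y, hy, lam, hlam, u, hu, hvu⟩ := exists_mem_XiSet_of_tendsto_FSub hf hg hconv hrsc hpcq
    hscq hcont (hx.comp hφ.tendsto_atTop) (fun k => hvk (φ k))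
    (fun k => (inv_pos.2 (hpos (φ k))).le) (ht.comp hφ.tendsto_atTop) hlim
  rw [zero_smul, zero_add, hzero y hy lam hlam u hu] at hvu
  simp [hvu] at hv

end ValueFunction

end

/-- Corollary 3.3 — Lipschitz continuity and strict differentiability of the
value function via the Wolfe dual estimates. -/
theorem stmt7 {n m q : ℕ}
    (f : EuclideanSpace ℝ (Fin n) → EuclideanSpace ℝ (Fin m) → ℝ)
    (g : EuclideanSpace ℝ (Fin n) → EuclideanSpace ℝ (Fin m) → Fin q → ℝ)
    (hf : ContDiff ℝ 2 (fun p : EuclideanSpace ℝ (Fin n) × EuclideanSpace ℝ (Fin m) => f p.1 p.2))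
    (hg : ∀ i, ContDiff ℝ 2
      (fun p : EuclideanSpace ℝ (Fin n) × EuclideanSpace ℝ (Fin m) => g p.1 p.2 i))
    (xb : EuclideanSpace ℝ (Fin n))
    (hconv : ∃ δ : ℝ, 0 < δ ∧ ∀ x ∈ Metric.ball xb δ,
      ConcaveOn ℝ Set.univ (f x) ∧ ∀ i, ConvexOn ℝ Set.univ (fun y => g x y i))
    (hrsc : RestrictedSupCompact f g xb)
    (hpcq : ∀ y ∈ Sol f g xb, StableParamCQ f g xb y)
    (hscq : ∀ y ∈ Sol f g xb, ∀ lam ∈ SigmaSet f g xb y,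
      StableCQ (WolfeG n m q) (WolfeH f g) (xb, y, lam))
    (hcont : ContinuousAt (Vfun f g) xb)
    (hzero : {v | ∃ y ∈ Sol f g xb, ∃ lam ∈ SigmaSet f g xb y, ∃ u ∈ XiSet 0 f g xb y lam,
        v = hessxyLu f g xb y lam u} = {0}) :
    (LipschitzNearAt (Vfun f g) xb ∧
      LSub (Vfun f g) xb ⊆
        {v | ∃ y ∈ Sol f g xb, ∃ lam ∈ SigmaSet f g xb y, ∃ u ∈ XiSet 1 f g xb y lam,
          v = gradxL f g xb y lam + hessxyLu f g xb y lam u}) ∧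
    (∀ ζ : EuclideanSpace ℝ (Fin n),
      {v | ∃ y ∈ Sol f g xb, ∃ lam ∈ SigmaSet f g xb y, ∃ u ∈ XiSet 1 f g xb y lam,
        v = gradxL f g xb y lam + hessxyLu f g xb y lam u} = {ζ} →
      StrictDiffAt (Vfun f g) xb ζ) := by
  have hzero' : ∀ y ∈ Sol f g xb, ∀ lam ∈ SigmaSet f g xb y, ∀ u ∈ XiSet 0 f g xb y lam,
      hessxyLu f g xb y lam u = 0 := fun y hy lam hlam u hu =>
    hzero.subset ⟨y, hy, lam, hlam, u, hu, rfl⟩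
  obtain ⟨R, hR, hfin, hcts⟩ := exists_ball_continuousOn_Vfun hf hg hconv hrsc hpcq hcont
  obtain ⟨K, δ, hK, hδ, hbd⟩ := exists_bound_FSub hf hg hconv hrsc hpcq hscq hcont hzero'
  have hLSub : LSub (Vfun f g) xb ⊆
      {v | ∃ y ∈ Sol f g xb, ∃ lam ∈ SigmaSet f g xb y, ∃ u ∈ XiSet 1 f g xb y lam,
        v = gradxL f g xb y lam + hessxyLu f g xb y lam u} := by
    rintro v ⟨xk, vk, hvk, hx, -, hv⟩
    obtain ⟨y, hy, lam, hlam, u, hu, hvu⟩ := exists_mem_XiSet_of_tendsto_FSub hf hg hconv hrsc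
      hpcq hscq hcont (tk := fun _ => 1) hx hvk (fun _ => zero_le_one) tendsto_const_nhds
      (by simpa using hv)
    exact ⟨y, hy, lam, hlam, u, hu, by rwa [one_smul] at hvu⟩
  refine ⟨⟨?_, hLSub⟩, fun ζ hζ ε hε => ?_⟩
  · obtain ⟨C, r, hC, hr, hrR, hbound⟩ := exists_quadratic_lipschitz_bound_of_FSub (xb := xb)
      (lt_min hR hδ) hK (fun x hx => hfin x (ball_subset_ball (min_le_left _ _) hx))
      (hcts.mono (ball_subset_ball (min_le_left _ _))) 0
      (fun x hx v hv => by
        rw [sub_zero]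
        exact hbd x (ball_subset_ball (min_le_right _ _) hx) v hv) (lt_add_one K)
    have hlip : LipschitzOnWith (K + 1 + C * (2 * r)).toNNReal
        (fun x => (Vfun f g x).toReal) (ball xb r) := by
      refine LipschitzOnWith.of_dist_le_mul fun x hx x' hx' => ?_
      rw [Real.coe_toNNReal _ (by positivity), Real.dist_eq, dist_eq_norm]
      have h1 := hbound x hx x' hx'
      rw [inner_zero_left, sub_zero] at h1
      have h2 : ‖x - x'‖ ≤ 2 * r := by
        have := dist_triangle_right x x' xb
        rw [mem_ball] at hx hx'
        rw [← dist_eq_norm]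
        linarith
      nlinarith [mul_le_mul_of_nonneg_left h2 (mul_nonneg hC (norm_nonneg (x - x')))]
    obtain ⟨ψ, hψ, heq⟩ := hlip.extend_real
    refine ⟨r, hr, _, ψ, hψ, fun x hx => ?_⟩
    rw [← heq hx]
    exact hfin x (ball_subset_ball (hrR.trans (min_le_left _ _)) hx)
  · have hclose : ∃ δ' : ℝ, 0 < δ' ∧ ∀ x ∈ ball xb δ', ∀ v ∈ FSub (Vfun f g) x,
        ‖v - ζ‖ ≤ ε / 4 := by
      by_contra! hcon
      choose xk hxk vk hvk hlt using fun k : ℕ =>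
        hcon (1 / ((k : ℝ) + 1)) Nat.one_div_pos_of_nat
      have hx : Tendsto xk atTop (𝓝 xb) :=
        tendsto_iff_dist_tendsto_zero.2 <| squeeze_zero (fun _ => dist_nonneg)
          (fun k => (mem_ball.1 (hxk k)).le) tendsto_one_div_add_atTop_nhds_zero_nat
      obtain ⟨φ₁, hφ₁, hball⟩ := extraction_of_eventually_atTop (hx (ball_mem_nhds xb hδ))
      obtain ⟨v, -, φ₂, hφ₂, hv⟩ := tendsto_subseq_of_bounded
        (isBounded_closedBall (x := (0 : EuclideanSpace ℝ (Fin n))) (r := K))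
        (x := fun k => vk (φ₁ k)) fun k => by
          simpa using hbd _ (hball k) _ (hvk (φ₁ k))
      have hx' := hx.comp (hφ₁.tendsto_atTop.comp hφ₂.tendsto_atTop)
      have hmem : v ∈ LSub (Vfun f g) xb :=
        ⟨_, _, fun k => hvk (φ₁ (φ₂ k)), hx', hcont.tendsto.comp hx', hv⟩
      have hvζ : v = ζ := by
        have := hLSub hmem
        rwa [hζ] at this
      have h1 : ε / 4 ≤ ‖v - ζ‖ :=
        ge_of_tendsto' (hv.sub_const ζ).norm fun k => (hlt (φ₁ (φ₂ k))).le
      rw [hvζ, sub_self, norm_zero] at h1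
      linarith
    obtain ⟨δ', hδ', hclose⟩ := hclose
    obtain ⟨C, r, hC, hr, hrR, hbound⟩ := exists_quadratic_lipschitz_bound_of_FSub (xb := xb)
      (lt_min hR hδ') (by positivity : 0 ≤ ε / 4)
      (fun x hx => hfin x (ball_subset_ball (min_le_left _ _) hx))
      (hcts.mono (ball_subset_ball (min_le_left _ _))) ζ
      (fun x hx v hv => hclose x (ball_subset_ball (min_le_right _ _) hx) v hv)
      (by linarith : ε / 4 < ε / 2)
    refine ⟨min r (ε / (4 * (C + 1))), by positivity, fun x x' hx hx' => ?_⟩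
    have hxr : x ∈ ball xb r := by
      rw [mem_ball, dist_eq_norm]
      exact hx.trans_le (min_le_left _ _)
    have hxr' : x' ∈ ball xb r := by
      rw [mem_ball, dist_eq_norm]
      exact hx'.trans_le (min_le_left _ _)
    have hsub := ball_subset_ball (x := xb) (hrR.trans (min_le_left _ _))
    refine ⟨_, _, hfin x (hsub hxr), hfin x' (hsub hxr'), (hbound x hxr x' hxr').trans ?_⟩
    have h1 : ‖x - x'‖ ≤ 2 * (ε / (4 * (C + 1))) := by
      have h2 := hx.trans_le (min_le_right _ _)
      have h3 := hx'.trans_le (min_le_right _ _)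
      have h4 := norm_sub_le_norm_sub_add_norm_sub x xb x'
      rw [norm_sub_rev xb x'] at h4
      linarith
    have h2 : C * ‖x - x'‖ ≤ ε / 2 := by
      calc C * ‖x - x'‖ ≤ (C + 1) * (2 * (ε / (4 * (C + 1)))) := by gcongr; linarith
        _ = ε / 2 := by field_simp; norm_num
    nlinarith [norm_nonneg (x - x')]
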